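/- Let 𝒫 be a Beurling generalized prime system and ρ > 0. Suppose the sets {θ ∈ ℝ : ψ_𝒫(x) − x = O(x^θ)} and {θ ∈ ℝ : N_𝒫(x) − ρx = O(x^θ)} are nonempty with infima α and β satisfying β < α < 1. Then the set {θ ∈ ℝ : M_𝒫(x) = O(x^θ)} is nonempty and its infimum γ equals α. -/

import Mathlib

open Filter Asymptotics
/-- ψ_𝒫(x): sum of log pᵢ over pairs (i,k) with k ≥ 1 and pᵢ^k ≤ x. -/
noncomputable def psiP (p : ℕ → ℝ) (x : ℝ) : ℝ :=
  ∑ᶠ ik ∈ {ik : ℕ × ℕ | 1 ≤ ik.2 ∧ p ik.1 ^ ik.2 ≤ x}, Real.log (p ik.1)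

/-- N_𝒫(x): number of finitely supported e : ℕ → ℕ with ∏ pᵢ^{e i} ≤ x. -/
noncomputable def NP (p : ℕ → ℝ) (x : ℝ) : ℕ :=
  Nat.card {e : ℕ →₀ ℕ | ∏ i ∈ e.support, p i ^ e i ≤ x}

/-- M_𝒫(x): sum of (−1)^|S| over finite S ⊆ ℕ with ∏_{i∈S} pᵢ ≤ x. -/
noncomputable def MP (p : ℕ → ℝ) (x : ℝ) : ℝ :=
  ∑ᶠ S ∈ {S : Finset ℕ | ∏ i ∈ S, p i ≤ x}, (-1 : ℝ) ^ S.card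


/-- Mellin-type transform `∫_1^∞ A(x) x^{-s-1} dx`. -/
noncomputable def RM (A : ℝ → ℝ) (s : ℂ) : ℂ :=
  mellin (fun x => (((Set.Ici (1:ℝ)).indicator A x : ℝ) : ℂ)) (-s)

open MeasureTheory Set Complex in
lemma RM_eq (A : ℝ → ℝ) (s : ℂ) : RM A s = ∫ x in Ioi (1:ℝ), (x:ℂ) ^ (-s-1) * (A x : ℂ) := by
  unfold RM mellin
  rw [← integral_Ici_eq_integral_Ioi (x := 1)]
  rw [← integral_indicator measurableSet_Ici, ← integral_indicator measurableSet_Ioi]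
  congr 1
  ext x
  by_cases hx : (1:ℝ) ≤ x
  · have : (0:ℝ) < x := by linarith
    simp [indicator, hx, this]
  · simp [indicator, hx]

section
open MeasureTheory Set Complex

variable {A : ℝ → ℝ} {C θ : ℝ}

lemma RM_locInt (hA : Measurable A) (hC : ∀ x, 1 ≤ x → |A x| ≤ C * x ^ θ) :
    LocallyIntegrableOn (fun x => (((Set.Ici (1:ℝ)).indicator A x : ℝ) : ℂ)) (Ioi 0) := by
  have hcont : ContinuousOn (fun x : ℝ => C * x ^ θ) (Ioi 0) := by
    apply ContinuousOn.mul continuousOn_const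
    intro x hx
    exact (Real.continuousAt_rpow_const x θ (Or.inl (ne_of_gt hx))).continuousWithinAt
  have h1 := hcont.locallyIntegrableOn (μ := volume) measurableSet_Ioi
  refine h1.mono ?_ ?_
  · exact (measurable_ofReal.comp (hA.indicator measurableSet_Ici)).aestronglyMeasurable
  · refine Eventually.of_forall fun x => ?_
    by_cases hx : (1:ℝ) ≤ x
    · simp only [indicator, mem_Ici, hx, if_true, norm_real, Real.norm_eq_abs]
      exact (hC x hx).trans (le_abs_self _)
    · simp only [indicator, mem_Ici, hx, if_false, ofReal_zero, norm_zero]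
      exact norm_nonneg _

lemma RM_bigO_top (hC : ∀ x, 1 ≤ x → |A x| ≤ C * x ^ θ) :
    (fun x => (((Set.Ici (1:ℝ)).indicator A x : ℝ) : ℂ)) =O[atTop] (fun x : ℝ => x ^ (-(-θ))) := by
  refine IsBigO.of_bound C ?_
  filter_upwards [eventually_ge_atTop 1] with x hx
  have : 0 ≤ x ^ θ := Real.rpow_nonneg (by linarith) _
  simp only [indicator, mem_Ici, hx, if_true, norm_real, Real.norm_eq_abs, neg_neg, abs_of_nonneg this]
  exact hC x hx

lemma RM_bigO_bot (A : ℝ → ℝ) (b : ℝ) :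
    (fun x => (((Set.Ici (1:ℝ)).indicator A x : ℝ) : ℂ)) =O[nhdsWithin 0 (Ioi 0)]
      (fun x : ℝ => x ^ (-b)) := by
  refine IsBigO.of_bound 1 ?_
  have : ∀ᶠ x : ℝ in nhdsWithin 0 (Ioi 0), x < 1 :=
    nhdsWithin_le_nhds (Iio_mem_nhds (by norm_num))
  filter_upwards [this] with x hx
  simp [indicator, not_le.mpr hx]

lemma RM_conv (hA : Measurable A) (hC : ∀ x, 1 ≤ x → |A x| ≤ C * x ^ θ) {s : ℂ} (hs : θ < s.re) :
    MellinConvergent (fun x => (((Set.Ici (1:ℝ)).indicator A x : ℝ) : ℂ)) (-s) :=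
  mellinConvergent_of_isBigO_rpow (a := -θ) (b := -s.re - 1) (RM_locInt hA hC) (RM_bigO_top hC)
    (by simp; linarith) (RM_bigO_bot A _) (by simp)

lemma RM_diff (hA : Measurable A) (hC : ∀ x, 1 ≤ x → |A x| ≤ C * x ^ θ) {s : ℂ} (hs : θ < s.re) :
    DifferentiableAt ℂ (RM A) s := by
  have := mellin_differentiableAt_of_isBigO_rpow (s := -s) (a := -θ) (b := -s.re - 1)
    (RM_locInt hA hC) (RM_bigO_top hC)
    (by simp; linarith) (RM_bigO_bot A _) (by simp)
  exact DifferentiableAt.comp s this differentiableAt_id.neg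

lemma RM_int (hA : Measurable A) (hC : ∀ x, 1 ≤ x → |A x| ≤ C * x ^ θ) {s : ℂ} (hs : θ < s.re) :
    IntegrableOn (fun x : ℝ => (x:ℂ) ^ (-s-1) * (A x : ℂ)) (Ioi 1) := by
  have h := RM_conv hA hC hs
  unfold MellinConvergent at h
  refine (h.mono_set (Ioi_subset_Ioi zero_le_one)).congr_fun ?_ measurableSet_Ioi
  intro x hx
  have hx1 : (1:ℝ) ≤ x := le_of_lt (mem_Ioi.mp hx)
  simp [indicator, hx1]

lemma RM_bound (hC : ∀ x, 1 ≤ x → |A x| ≤ C * x ^ θ) {s : ℂ}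
    (hs : θ < s.re) : ‖RM A s‖ ≤ C / (s.re - θ) := by
  rw [RM_eq]
  have h1 : IntegrableOn (fun x : ℝ => C * x ^ (θ - s.re - 1)) (Ioi 1) :=
    (integrableOn_Ioi_rpow_of_lt (by linarith) one_pos).const_mul C
  have h2 : ∫ x in Ioi (1:ℝ), C * x ^ (θ - s.re - 1) = C / (s.re - θ) := by
    rw [integral_const_mul, integral_Ioi_rpow_of_lt (by linarith) one_pos]
    rw [Real.one_rpow]
    have : s.re - θ ≠ 0 := by linarith
    have : θ - s.re - 1 + 1 ≠ 0 := by linarith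
    field_simp
    ring
  rw [← h2]
  refine norm_integral_le_of_norm_le h1 ?_
  refine (ae_restrict_iff' measurableSet_Ioi).mpr (Eventually.of_forall fun x hx => ?_)
  have hx0 : (0:ℝ) < x := lt_trans one_pos hx
  rw [norm_mul, norm_cpow_eq_rpow_re_of_pos hx0, norm_real, Real.norm_eq_abs]
  calc x ^ (-s-1).re * |A x| ≤ x ^ (-s-1).re * (C * x ^ θ) := by
        gcongr
        exact hC x (le_of_lt hx)
    _ = C * (x ^ (-s-1).re * x ^ θ) := by ring
    _ = _ := by
        rw [← Real.rpow_add hx0]; congr 2; simp; ring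

lemma RM_sub {B : ℝ → ℝ} {C' : ℝ} (hA : Measurable A) (hC : ∀ x, 1 ≤ x → |A x| ≤ C * x ^ θ)
    (hB : Measurable B) (hC' : ∀ x, 1 ≤ x → |B x| ≤ C' * x ^ θ) {s : ℂ} (hs : θ < s.re) :
    RM (fun x => A x - B x) s = RM A s - RM B s := by
  rw [RM_eq, RM_eq, RM_eq, ← integral_sub (RM_int hA hC hs) (RM_int hB hC' hs)]
  congr 1; ext x; push_cast; ring

lemma RM_lin (ρ : ℝ) {s : ℂ} (hs : 1 < s.re) : RM (fun x => ρ * x) s = ρ / (s - 1) := by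
  rw [RM_eq]
  have h : ∀ x ∈ Ioi (1:ℝ), (x:ℂ) ^ (-s-1) * ((ρ * x : ℝ) : ℂ) = (ρ:ℂ) * (x:ℂ) ^ (-s) := by
    intro x hx
    have hx0 : (x:ℂ) ≠ 0 := by
      have : (1:ℝ) < x := hx
      exact_mod_cast (by linarith : x ≠ 0)
    rw [cpow_sub _ _ hx0, cpow_one]
    push_cast; field_simp
  rw [setIntegral_congr_fun measurableSet_Ioi h, integral_const_mul,
    integral_Ioi_cpow_of_lt (by simpa using hs) one_pos]
  have : s - 1 ≠ 0 := by
    intro h; rw [sub_eq_zero] at h; rw [h] at hs; simp at hs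
  have : -s + 1 ≠ 0 := by
    intro h'; apply this; linear_combination -h'
  simp; field_simp; ring

/-- `RM` of the primitive. -/
lemma RM_prim (hA : Measurable A) (hC : ∀ x, 1 ≤ x → |A x| ≤ C * x) {s : ℂ} (hs : 1 < s.re) :
    RM (fun x => ∫ u in (1:ℝ)..x, A u) (s + 1) = RM A s / (s + 1) := by
  rw [RM_eq, RM_eq]
  set μ := (volume.restrict (Ioi (1:ℝ)))
  set F : ℝ → ℝ → ℂ := fun u x => (Ioc 1 x).indicator (fun u => (A u:ℂ)) u * (x:ℂ) ^ (-(s+1)-1) with hF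
  have hs1 : s + 1 ≠ 0 := by
    intro h
    have := congrArg re h
    simp at this; linarith
  have hFu : ∀ u ∈ Ioi (1:ℝ), ∀ x ∈ Ioi (1:ℝ), F u x = (Ici u).indicator (fun x : ℝ => (A u:ℂ) * (x:ℂ) ^ (-(s+1)-1)) x := by
    intro u hu x hx
    have hu' : 1 < u := hu
    by_cases h : u ≤ x <;> simp [hF, indicator, h, hu']
  have hmeas : Measurable (Function.uncurry F) := by
    have : Function.uncurry F = fun z : ℝ × ℝ => {z : ℝ × ℝ | 1 < z.1 ∧ z.1 ≤ z.2}.indicator (fun z => (A z.1 : ℂ)) z * (z.2:ℂ) ^ (-(s+1)-1) := by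
      ext ⟨u, x⟩
      simp [hF, indicator, Function.uncurry]
    rw [this]
    apply Measurable.mul
    · apply Measurable.indicator
      · exact measurable_ofReal.comp (hA.comp measurable_fst)
      · exact (measurableSet_lt measurable_const measurable_fst).inter (measurableSet_le measurable_fst measurable_snd)
    · exact Measurable.pow_const (measurable_ofReal.comp measurable_snd) _
  have hre : (-(s+1)-1).re < -1 := by simp; linarith
  have hint1 : ∀ u ∈ Ioi (1:ℝ), Integrable (F u) μ := by
    intro u hu
    have hu0 : (0:ℝ) < u := lt_trans one_pos hu
    have : IntegrableOn ((Ici u).indicator (fun x : ℝ => (A u:ℂ) * (x:ℂ) ^ (-(s+1)-1))) (Ioi 1) := by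
      apply Integrable.integrableOn
      rw [integrable_indicator_iff measurableSet_Ici, integrableOn_Ici_iff_integrableOn_Ioi]
      exact (integrableOn_Ioi_cpow_of_lt hre hu0).const_mul _
    exact this.congr_fun (fun x hx => (hFu u hu x hx).symm) measurableSet_Ioi
  have hval : ∀ u ∈ Ioi (1:ℝ), ∫ x, F u x ∂μ = (u:ℂ) ^ (-s-1) * (A u : ℂ) / (s+1) := by
    intro u hu
    have hu0 : (0:ℝ) < u := lt_trans one_pos hu
    have hu1 : (1:ℝ) < u := hu
    rw [setIntegral_congr_fun measurableSet_Ioi (hFu u hu), setIntegral_indicator measurableSet_Ici,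
      inter_eq_right.mpr (Ici_subset_Ioi.mpr hu1), integral_Ici_eq_integral_Ioi,
      integral_const_mul, integral_Ioi_cpow_of_lt hre hu0]
    have h1 : (-(s+1)-1 + 1 : ℂ) = -s-1 := by ring
    rw [h1]
    have : -s-1 ≠ 0 := by intro h; apply hs1; linear_combination -h
    field_simp; ring
  have hnorm : ∀ u ∈ Ioi (1:ℝ), ∫ x, ‖F u x‖ ∂μ = |A u| * (u ^ (-s.re-1) / (s.re+1)) := by
    intro u hu
    have hu0 : (0:ℝ) < u := lt_trans one_pos hu
    have hu1 : (1:ℝ) < u := hu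
    have h2 : ∀ x ∈ Ioi (1:ℝ), ‖F u x‖ = (Ici u).indicator (fun x : ℝ => |A u| * x ^ (-(s.re+1)-1)) x := by
      intro x hx
      rw [hFu u hu x hx, norm_indicator_eq_indicator_norm]
      have hx0 : (0:ℝ) < x := lt_trans one_pos hx
      by_cases h : u ≤ x
      · simp [indicator, h, norm_cpow_eq_rpow_re_of_pos hx0]
      · simp [indicator, h]
    rw [setIntegral_congr_fun measurableSet_Ioi h2, setIntegral_indicator measurableSet_Ici,
      inter_eq_right.mpr (Ici_subset_Ioi.mpr hu1), integral_Ici_eq_integral_Ioi,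
      integral_const_mul, integral_Ioi_rpow_of_lt (by linarith) hu0]
    have h1 : (-(s.re+1)-1 + 1 : ℝ) = -s.re-1 := by ring
    rw [h1]
    have : -s.re-1 ≠ 0 := by linarith
    have : s.re+1 ≠ 0 := by linarith
    field_simp; ring
  have hprod : Integrable (Function.uncurry F) (μ.prod μ) := by
    rw [integrable_prod_iff hmeas.aestronglyMeasurable]
    constructor
    · exact (ae_restrict_iff' measurableSet_Ioi).mpr (Eventually.of_forall fun u hu => hint1 u hu)
    · have h3 : IntegrableOn (fun u : ℝ => C / (s.re+1) * u ^ (-s.re)) (Ioi 1) :=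
        (integrableOn_Ioi_rpow_of_lt (by linarith) one_pos).const_mul _
      refine Integrable.mono' h3 ?_ ?_
      · exact (hmeas.aestronglyMeasurable (μ := μ.prod μ)).norm.integral_prod_right'
      · refine (ae_restrict_iff' measurableSet_Ioi).mpr (Eventually.of_forall fun u hu => ?_)
        have hu0 : (0:ℝ) < u := lt_trans one_pos hu
        have := hnorm u hu
        simp only [Function.uncurry]
        rw [this, Real.norm_eq_abs, abs_of_nonneg (by
          have : 0 < s.re + 1 := by linarith
          positivity)]
        have h4 : u ^ (-s.re) = u * u ^ (-s.re-1) := by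
          rw [Real.rpow_sub hu0, Real.rpow_one]; field_simp
        rw [h4]
        have h5 : 0 < s.re + 1 := by linarith
        calc |A u| * (u ^ (-s.re-1) / (s.re+1)) ≤ (C * u) * (u ^ (-s.re-1) / (s.re+1)) := by
              gcongr
              exact hC u (le_of_lt hu)
          _ = _ := by ring
  have hswap := integral_integral_swap hprod
  have hL : ∫ u, ∫ x, F u x ∂μ ∂μ = (∫ u in Ioi (1:ℝ), (u:ℂ) ^ (-s-1) * (A u : ℂ)) / (s+1) := by
    rw [setIntegral_congr_fun measurableSet_Ioi hval, integral_div]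
  rw [← hL, hswap]
  refine setIntegral_congr_fun measurableSet_Ioi fun x hx => ?_
  have hx1 : (1:ℝ) < x := hx
  simp only [hF]
  rw [integral_mul_const, setIntegral_indicator measurableSet_Ioc,
    inter_eq_right.mpr Ioc_subset_Ioi_self, intervalIntegral.integral_of_le hx1.le,
    integral_complex_ofReal, mul_comm]
end

section
open MeasureTheory Set Complex

lemma integrable_vert_pow {r : ℝ} (hr : 1 < r) :
    Integrable (fun t : ℝ => (1 + |t|) ^ (-r)) := by
  have := integrable_one_add_norm (E := ℝ) (μ := volume) (r := r) (by simpa using hr)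
  simpa using this

lemma contour_shift (W : ℂ → ℂ) {σ c B r : ℝ} (hσc : σ ≤ c) (hr : 1 < r)
    (hd : DifferentiableOn ℂ W {s | σ ≤ s.re ∧ s.re ≤ c})
    (hb : ∀ s : ℂ, σ ≤ s.re → s.re ≤ c → ‖W s‖ ≤ B * (1 + |s.im|) ^ (-r)) :
    ∫ t : ℝ, W (σ + t * I) = ∫ t : ℝ, W (c + t * I) := by
  have hcont : ∀ a : ℝ, σ ≤ a → a ≤ c → Continuous (fun t : ℝ => W (a + t * I)) := by
    intro a h1 h2
    apply hd.continuousOn.comp_continuous (by fun_prop)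
    intro t; simp [h1, h2]
  have hInteg : ∀ a : ℝ, σ ≤ a → a ≤ c → Integrable (fun t : ℝ => W (a + t * I)) := by
    intro a h1 h2
    refine Integrable.mono' ((integrable_vert_pow hr).const_mul B)
      (hcont a h1 h2).aestronglyMeasurable (Eventually.of_forall fun t => ?_)
    simpa using hb (a + t * I) (by simpa using h1) (by simpa using h2)
  have hlim : ∀ a : ℝ, σ ≤ a → a ≤ c → Tendsto (fun T : ℝ => ∫ t in (-T)..T, W (a + t * I)) atTop
      (nhds (∫ t : ℝ, W (a + t * I))) := fun a h1 h2 =>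
    intervalIntegral_tendsto_integral (hInteg a h1 h2) tendsto_neg_atTop_atBot tendsto_id
  have hz : Tendsto (fun T : ℝ => B * (1 + T) ^ (-r) * |c - σ|) atTop (nhds 0) := by
    have h1 : Tendsto (fun T : ℝ => (1 + T) ^ (-r)) atTop (nhds 0) :=
      (tendsto_rpow_neg_atTop (by linarith)).comp (tendsto_atTop_add_const_left _ 1 tendsto_id)
    simpa using (h1.const_mul B).mul_const (|c - σ|)
  have hhor : ∀ τ : ℝ → ℝ, (∀ T, |τ T| = |T|) → Tendsto (fun T : ℝ => ∫ x in σ..c, W (x + τ T * I)) atTop (nhds 0) := by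
    intro τ hτ
    refine squeeze_zero_norm' ?_ hz
    filter_upwards [eventually_ge_atTop 0] with T hT
    apply intervalIntegral.norm_integral_le_of_norm_le_const
    intro x hx
    rw [uIoc_of_le hσc] at hx
    have := hb (x + τ T * I) (by simpa using hx.1.le) (by simpa using hx.2)
    simpa [hτ, abs_of_nonneg hT] using this
  have hrect : ∀ T : ℝ, 0 ≤ T → I * (∫ t in (-T)..T, W (σ + t * I)) = (∫ x in σ..c, W (x + ((-T : ℝ) : ℂ) * I)) -
      (∫ x in σ..c, W (x + (T:ℂ) * I)) + I * (∫ t in (-T)..T, W (c + t * I)) := by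
    intro T hT
    have := integral_boundary_rect_eq_zero_of_differentiableOn W (σ + ((-T:ℝ):ℂ) * I) (c + T * I) (by
      apply hd.mono
      intro s hs
      rw [mem_reProdIm] at hs
      have := hs.1
      simp only [add_re, ofReal_re, mul_re, I_re, mul_zero, ofReal_im, I_im, mul_one, sub_self, add_zero, uIcc_of_le hσc] at this
      exact this)
    simp only [add_re, ofReal_re, mul_re, I_re, mul_zero, ofReal_im, I_im, mul_one, sub_self, add_zero, add_im, mul_im, zero_add, smul_eq_mul] at this
    linear_combination -this
  have h1 := (hlim σ le_rfl hσc).const_mul I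
  have h2 := ((hhor (fun T => -T) (by simp)).sub (hhor (fun T => T) (by simp))).add ((hlim c hσc le_rfl).const_mul I)
  have := tendsto_nhds_unique h1 (h2.congr' (by
    filter_upwards [eventually_ge_atTop 0] with T hT using (hrect T hT).symm))
  simpa using this

lemma norm_cpow_sub_le {x y : ℝ} (hx : 0 < x) (hxy : x ≤ y) {s : ℂ} (hs : 0 ≤ s.re) :
    ‖((y:ℂ) ^ (s+1) - (x:ℂ) ^ (s+1)) / (s+1)‖ ≤ (y - x) * y ^ s.re := by
  have hs1 : s + 1 ≠ 0 := by
    intro h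
    have := congrArg re h
    simp at this; linarith
  have h := integral_cpow (a := x) (b := y) (r := s) (Or.inl (by linarith))
  rw [← h]
  have := intervalIntegral.norm_integral_le_of_norm_le_const (a := x) (b := y) (f := fun u : ℝ => (u:ℂ)^s) (C := y ^ s.re) ?_
  · rwa [abs_of_nonneg (by linarith), mul_comm] at this
  · intro u hu
    rw [uIoc_of_le hxy] at hu
    have hu0 : 0 < u := lt_trans hx hu.1
    rw [norm_cpow_eq_rpow_re_of_pos hu0]
    exact Real.rpow_le_rpow hu0.le hu.2 hs

lemma one_add_abs_im_le {s : ℂ} (hs : 0 ≤ s.re) : 1 + |s.im| ≤ 2 * ‖s + 1‖ := by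
  have h1 := abs_re_le_norm (s+1)
  have h2 := abs_im_le_norm (s+1)
  simp at h1 h2
  have := le_abs_self (s.re + 1)
  linarith

lemma norm_cpow_sub_le' {x y : ℝ} (hx : 0 < x) (hxy : x ≤ y) {s : ℂ} (hs : 0 ≤ s.re) :
    ‖((y:ℂ) ^ (s+1) - (x:ℂ) ^ (s+1)) / (s+1)‖ ≤ 4 * y ^ (s.re + 1) * (1 + |s.im|)⁻¹ := by
  have h0 : 0 < 1 + |s.im| := by positivity
  have h1 := one_add_abs_im_le hs
  have h2 : 0 < ‖s+1‖ := by linarith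
  rw [norm_div]
  have h3 : ‖(y:ℂ) ^ (s+1) - (x:ℂ) ^ (s+1)‖ ≤ 2 * y ^ (s.re + 1) := by
    refine (norm_sub_le _ _).trans ?_
    rw [norm_cpow_eq_rpow_re_of_pos hx, norm_cpow_eq_rpow_re_of_pos (hx.trans_le hxy)]
    have := Real.rpow_le_rpow hx.le hxy (z := s.re + 1) (by linarith)
    simp; linarith
  have hy : 0 ≤ y ^ (s.re + 1) := Real.rpow_nonneg (by linarith) _
  rw [div_le_iff₀ h2]
  calc _ ≤ 2 * y ^ (s.re + 1) := h3
    _ = 2 * y ^ (s.re + 1) * ((1 + |s.im|)⁻¹ * (1 + |s.im|)) := by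
      rw [inv_mul_cancel₀ h0.ne', mul_one]
    _ ≤ 2 * y ^ (s.re + 1) * ((1 + |s.im|)⁻¹ * (2 * ‖s+1‖)) := by gcongr
    _ = _ := by ring

lemma norm_cpow_sub_le'' {x y δ : ℝ} (hx : 0 < x) (hxy : x ≤ y) {s : ℂ} (hs : 0 ≤ s.re)
    (hδ : 0 < δ) (hδ1 : δ < 1) :
    ‖((y:ℂ) ^ (s+1) - (x:ℂ) ^ (s+1)) / (s+1)‖ ≤
      4 * (y - x) ^ (1 - δ) * y ^ (s.re + δ) * (1 + |s.im|) ^ (-δ) := by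
  have h1 := norm_cpow_sub_le hx hxy hs
  have h2 := norm_cpow_sub_le' hx hxy hs
  set X := ‖((y:ℂ) ^ (s+1) - (x:ℂ) ^ (s+1)) / (s+1)‖
  have hX : 0 ≤ X := norm_nonneg _
  have hy : 0 < y := hx.trans_le hxy
  have h0 : 0 < 1 + |s.im| := by positivity
  have hyx : 0 ≤ y - x := by linarith
  calc X = X ^ (1 - δ) * X ^ δ := by
        rw [← Real.rpow_add_of_nonneg hX (by linarith) hδ.le]; simp
    _ ≤ ((y - x) * y ^ s.re) ^ (1 - δ) * (4 * y ^ (s.re + 1) * (1 + |s.im|)⁻¹) ^ δ := by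
        gcongr
    _ = 4 ^ δ * (y - x) ^ (1 - δ) * y ^ (s.re + δ) * (1 + |s.im|) ^ (-δ) := by
        rw [Real.mul_rpow hyx (by positivity), Real.mul_rpow (by positivity) (by positivity),
          Real.mul_rpow (by positivity) (by positivity), ← Real.rpow_mul hy.le, ← Real.rpow_mul hy.le,
          Real.inv_rpow h0.le, ← Real.rpow_neg h0.le]
        have : y ^ (s.re + δ) = y ^ (s.re * (1 - δ)) * y ^ ((s.re + 1) * δ) := by
          rw [← Real.rpow_add hy]; congr 1; ring
        rw [this]; ring
    _ ≤ _ := by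
        have : (4:ℝ) ^ δ ≤ 4 := by
          calc (4:ℝ) ^ δ ≤ 4 ^ (1:ℝ) := Real.rpow_le_rpow_of_exponent_le (by norm_num) hδ1.le
            _ = 4 := by simp
        have : 0 ≤ (y - x) ^ (1 - δ) := Real.rpow_nonneg hyx _
        gcongr

end

section
open MeasureTheory Set Complex

lemma intble_of_bound {A : ℝ → ℝ} {C : ℝ} (hA : Measurable A) (hC : ∀ x, 1 ≤ x → |A x| ≤ C * x)
    {a b : ℝ} (ha : 1 ≤ a) (hab : a ≤ b) : IntervalIntegrable A volume a b := by
  have hcont : Continuous (fun x : ℝ => C * x) := by fun_prop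
  refine (hcont.intervalIntegrable a b).mono_fun' hA.aestronglyMeasurable ?_
  refine (ae_restrict_iff' measurableSet_uIoc).mpr (Eventually.of_forall fun x hx => ?_)
  rw [uIoc_of_le hab] at hx
  exact hC x (ha.trans hx.1.le)

lemma prim_bound {A : ℝ → ℝ} {C : ℝ} (hC : ∀ x, 1 ≤ x → |A x| ≤ C * x)
    (hC0 : 0 ≤ C) :
    ∀ x, 1 ≤ x → |∫ u in (1:ℝ)..x, A u| ≤ C * x ^ (2:ℝ) := by
  intro x hx
  have := intervalIntegral.norm_integral_le_of_norm_le_const (a := 1) (b := x) (f := A) (C := C * x) ?_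
  · rw [Real.norm_eq_abs, abs_of_nonneg (by linarith : (0:ℝ) ≤ x - 1)] at this
    refine this.trans ?_
    norm_num
    nlinarith [mul_nonneg hC0 (by linarith : (0:ℝ) ≤ x)]
  · intro u hu
    rw [uIoc_of_le hx] at hu
    refine (hC u hu.1.le).trans ?_
    exact mul_le_mul_of_nonneg_left hu.2 hC0

lemma prim_cont {A : ℝ → ℝ} {C : ℝ} (hA : Measurable A) (hC : ∀ x, 1 ≤ x → |A x| ≤ C * x)
    {x : ℝ} (hx : 1 < x) : ContinuousAt (fun x => ∫ u in (1:ℝ)..x, A u) x := by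
  have h := intervalIntegral.continuousOn_primitive_interval (μ := volume) (f := A) (a := 1) (b := x + 1)
    (by
      have := (intble_of_bound hA hC le_rfl (by linarith : 1 ≤ x + 1)).1
      rw [uIcc_of_le (by linarith), integrableOn_Icc_iff_integrableOn_Ioc]
      exact this)
  apply h.continuousAt
  rw [uIcc_of_le (by linarith)]
  exact Icc_mem_nhds hx (by linarith)

lemma perron {A : ℝ → ℝ} {C K δ : ℝ} (hA : Measurable A) (hC0 : 0 ≤ C)
    (hC : ∀ x, 1 ≤ x → |A x| ≤ C * x) {E : ℂ → ℂ} (hδ1 : δ < 1)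
    (hEc : Continuous (fun t : ℝ => E (2 + t * I)))
    (hE : ∀ s : ℂ, 1 < s.re → E s = RM A s)
    (hK : ∀ s : ℂ, s.re = 2 → ‖E s‖ ≤ K * (1 + |s.im|) ^ (δ / 2 - 1)) {x : ℝ} (hx : 1 < x) :
    Integrable (fun t : ℝ => E (2 + t * I) / (2 + t * I + 1) * (x:ℂ) ^ (2 + t * I + 1)) ∧
    ((∫ u in (1:ℝ)..x, A u : ℝ) : ℂ) = (1 / (2 * Real.pi) : ℂ) *
      ∫ t : ℝ, E (2 + t * I) / (2 + t * I + 1) * (x:ℂ) ^ (2 + t * I + 1) := by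
  set A1 := fun x : ℝ => ∫ u in (1:ℝ)..x, A u with hA1
  have hx0 : 0 < x := by linarith
  have hne : ∀ t : ℝ, (2 + t * I + 1 : ℂ) ≠ 0 := by
    intro t h
    have := congrArg re h
    norm_num at this
  -- integrability of E/(s+1)
  have hint0 : Integrable (fun t : ℝ => E (2 + t * I) / (2 + t * I + 1)) := by
    refine Integrable.mono' ((integrable_vert_pow (r := 2 - δ / 2) (by linarith)).const_mul (2 * K)) ?_
      (Eventually.of_forall fun t => ?_)
    · apply Continuous.aestronglyMeasurable
      exact hEc.div (by fun_prop) hne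
    · have h1 := hK (2 + t * I) (by simp)
      have h2 := one_add_abs_im_le (s := 2 + t * I) (by simp)
      simp at h1 h2
      have h0 : 0 < 1 + |t| := by positivity
      rw [norm_div, div_le_iff₀ (by linarith)]
      have h3 : (1 + |t|) ^ (δ / 2 - 1) = (1 + |t|) ^ (-(2 - δ / 2)) * (1 + |t|) := by
        nth_rewrite 3 [← Real.rpow_one (1 + |t|)]
        rw [← Real.rpow_add h0]; congr 1; ring
      rw [h3] at h1
      have hKnn : 0 ≤ K * (1 + |t|) ^ (-(2 - δ / 2)) := by
        have := (norm_nonneg _).trans h1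
        rw [← mul_assoc] at this
        exact nonneg_of_mul_nonneg_left this h0
      calc _ ≤ _ := h1
        _ = (K * (1 + |t|) ^ (-(2 - δ / 2))) * (1 + |t|) := by ring
        _ ≤ (K * (1 + |t|) ^ (-(2 - δ / 2))) * (2 * ‖(2 + t * I + 1 : ℂ)‖) := by gcongr
        _ = _ := by ring
  have hInteg : Integrable (fun t : ℝ => E (2 + t * I) / (2 + t * I + 1) * (x:ℂ) ^ (2 + t * I + 1)) := by
    refine hint0.mul_bdd (c := x ^ (3:ℝ)) ?_ (Eventually.of_forall fun t => ?_)
    · apply Continuous.aestronglyMeasurable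
      exact Continuous.const_cpow (by fun_prop) (Or.inl (by exact_mod_cast hx0.ne'))
    · rw [norm_cpow_eq_rpow_re_of_pos hx0]
      simp; norm_num
  refine ⟨hInteg, ?_⟩
  set f : ℝ → ℂ := fun x => (((Set.Ici (1:ℝ)).indicator A1 x : ℝ) : ℂ) with hf
  have hmel : ∀ t : ℝ, mellin f (((-3:ℝ):ℂ) + (-t:ℝ) * I) = E (2 + t * I) / (2 + t * I + 1) := by
    intro t
    have h := RM_prim hA hC (s := 2 + t * I) (by simp)
    rw [← hE _ (by simp)] at h
    rw [← h]
    unfold RM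
    congr 1
    push_cast; ring
  have hconv : MellinConvergent f ((-3:ℝ):ℂ) := by
    have hfm : AEStronglyMeasurable (fun x => (A1 x : ℂ)) (volume.restrict (Ioi (1:ℝ))) := by
      apply ContinuousOn.aestronglyMeasurable _ measurableSet_Ioi
      intro y hy
      exact (continuous_ofReal.continuousAt.comp (prim_cont hA hC hy)).continuousWithinAt
    have hloc : IntegrableOn (fun t : ℝ => (t:ℂ) ^ (((-3:ℝ):ℂ) - 1) • (A1 t : ℂ)) (Ioi 1) := by
      refine Integrable.mono' ((integrableOn_Ioi_rpow_of_lt (a := -2) (by norm_num) one_pos).const_mul C) ?_ ?_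
      · refine AEStronglyMeasurable.smul (f := fun t : ℝ => (t:ℂ) ^ (((-3:ℝ):ℂ) - 1)) ?_ hfm
        apply ContinuousOn.aestronglyMeasurable _ measurableSet_Ioi
        intro y hy
        have : (0:ℝ) < y := lt_trans one_pos hy
        apply ContinuousAt.continuousWithinAt
        exact continuousAt_ofReal_cpow_const _ _ (Or.inr this.ne')
      · refine (ae_restrict_iff' measurableSet_Ioi).mpr (Eventually.of_forall fun y hy => ?_)
        have hy0 : (0:ℝ) < y := lt_trans one_pos hy
        rw [norm_smul, norm_cpow_eq_rpow_re_of_pos hy0, norm_real, Real.norm_eq_abs]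
        calc _ ≤ y ^ ((((-3:ℝ):ℂ) - 1).re) * (C * y ^ (2:ℝ)) := by
              gcongr
              exact prim_bound hC hC0 y (le_of_lt hy)
          _ = C * (y ^ ((((-3:ℝ):ℂ) - 1).re) * y ^ (2:ℝ)) := by ring
          _ = _ := by
              rw [← Real.rpow_add hy0]; norm_num
    unfold MellinConvergent
    have h2 : IntegrableOn (fun t : ℝ => (t:ℂ) ^ (((-3:ℝ):ℂ) - 1) • f t) (Ioc 0 1) := by
      have : IntegrableOn (fun t : ℝ => (0:ℂ)) (Ioc 0 1) := integrableOn_zero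
      refine this.congr_fun ?_ measurableSet_Ioc
      intro y hy
      by_cases h : y = 1
      · simp [hf, hA1, h]
      · have : ¬ (1 ≤ y) := fun h' => h (le_antisymm hy.2 h')
        simp [hf, this]
    rw [← Ioc_union_Ioi_eq_Ioi (zero_le_one' ℝ)]
    refine h2.union (hloc.congr_fun ?_ measurableSet_Ioi)
    intro y hy
    have : (1:ℝ) ≤ y := le_of_lt (mem_Ioi.mp hy)
    simp [hf, this]
  have hvi : VerticalIntegrable (mellin f) (-3) := by
    unfold VerticalIntegrable
    have := hint0.comp_neg
    refine this.congr (Eventually.of_forall fun t => ?_)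
    have := hmel (-t)
    simp only [neg_neg] at this
    simp only [this]
  have hca : ContinuousAt f x := by
    have : ContinuousAt (fun x => (A1 x : ℂ)) x := continuous_ofReal.continuousAt.comp (prim_cont hA hC hx)
    refine this.congr ?_
    filter_upwards [Ioi_mem_nhds hx] with y hy
    have : (1:ℝ) ≤ y := le_of_lt (mem_Ioi.mp hy)
    simp [hf, this]
  have hinv := mellinInv_mellin_eq (-3) f hx0 hconv hvi hca
  have hfx : f x = ((∫ u in (1:ℝ)..x, A u : ℝ) : ℂ) := by simp [hf, hx.le, hA1]
  rw [← hfx, ← hinv]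
  unfold mellinInv
  rw [← integral_neg_eq_self]
  simp only [smul_eq_mul]
  rw [Complex.real_smul]
  congr 1
  · push_cast; ring
  · congr 1
    ext t
    rw [hmel t, mul_comm]
    congr 2
    push_cast; ring

lemma prim_diff_bound {A : ℝ → ℝ} {C K δ σ : ℝ} (hA : Measurable A) (hC0 : 0 ≤ C)
    (hC : ∀ x, 1 ≤ x → |A x| ≤ C * x) {E : ℂ → ℂ} (hδ : 0 < δ) (hδ1 : δ < 1)
    (hσ : 0 ≤ σ) (hσ1 : σ < 2)
    (hEd : ∀ s : ℂ, σ ≤ s.re → DifferentiableAt ℂ E s)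
    (hE : ∀ s : ℂ, 1 < s.re → E s = RM A s)
    (hK : ∀ s : ℂ, σ ≤ s.re → ‖E s‖ ≤ K * (1 + |s.im|) ^ (δ / 2 - 1)) :
    ∃ K' : ℝ, 0 ≤ K' ∧ ∀ x y : ℝ, 1 < x → x ≤ y →
      |∫ u in x..y, A u| ≤ K' * ((y - x) ^ (1 - δ) * y ^ (σ + δ)) := by
  have hK0 : 0 ≤ K := by
    have h1 := (norm_nonneg _).trans (hK (σ : ℂ) (by simp))
    simpa using h1
  have hEc : Continuous (fun t : ℝ => E (2 + t * I)) := by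
    rw [continuous_iff_continuousAt]
    intro t
    refine ContinuousAt.comp (g := E) (hEd _ (by simp; linarith)).continuousAt ?_
    fun_prop
  set J := ∫ t : ℝ, (1 + |t|) ^ (-(1 + δ / 2))
  have hJ : 0 ≤ J := integral_nonneg fun t => by positivity
  refine ⟨1 / (2 * Real.pi) * (4 * K * J), by positivity, ?_⟩
  intro x y hx hxy
  have hx0 : 0 < x := by linarith
  have hy1 : 1 < y := by linarith
  have hy0 : 0 < y := by linarith
  obtain ⟨ix, px⟩ := perron hA hC0 hC hδ1 hEc hE (fun s hs => hK s (by linarith)) hx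
  obtain ⟨iy, py⟩ := perron hA hC0 hC hδ1 hEc hE (fun s hs => hK s (by linarith)) hy1
  set W : ℂ → ℂ := fun s => E s * (((y:ℂ) ^ (s+1) - (x:ℂ) ^ (s+1)) / (s+1)) with hW
  have hdiff : ((∫ u in x..y, A u : ℝ) : ℂ) = (1 / (2 * Real.pi) : ℂ) * ∫ t : ℝ, W (((2:ℝ):ℂ) + t * I) := by
    have h1 : ∫ u in x..y, A u = (∫ u in (1:ℝ)..y, A u) - ∫ u in (1:ℝ)..x, A u := by
      rw [intervalIntegral.integral_interval_sub_left]
      · exact intble_of_bound hA hC le_rfl hy1.le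
      · exact intble_of_bound hA hC le_rfl hx.le
    rw [h1, ofReal_sub, px, py, ← mul_sub, ← integral_sub iy ix]
    congr 2
    ext t
    simp only [hW]
    push_cast
    ring
  have hWb : ∀ s : ℂ, σ ≤ s.re → ‖W s‖ ≤ 4 * K * ((y - x) ^ (1 - δ) * y ^ (s.re + δ)) * (1 + |s.im|) ^ (-(1 + δ / 2)) := by
    intro s hs
    have h0 : 0 < 1 + |s.im| := by positivity
    have hyx : 0 ≤ (y - x) ^ (1 - δ) := Real.rpow_nonneg (by linarith) _
    rw [hW, norm_mul]
    calc _ ≤ (K * (1 + |s.im|) ^ (δ / 2 - 1)) * (4 * (y - x) ^ (1 - δ) * y ^ (s.re + δ) * (1 + |s.im|) ^ (-δ)) := by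
          gcongr
          · exact hK s hs
          · exact norm_cpow_sub_le'' hx0 hxy (hσ.trans hs) hδ hδ1
      _ = 4 * K * ((y - x) ^ (1 - δ) * y ^ (s.re + δ)) * ((1 + |s.im|) ^ (δ / 2 - 1) * (1 + |s.im|) ^ (-δ)) := by ring
      _ = _ := by
          rw [← Real.rpow_add h0]; congr 2; ring
  have hshift := contour_shift W (σ := σ) (c := 2) (r := 1 + δ / 2) hσ1.le (by linarith)
    (B := 4 * K * ((y - x) ^ (1 - δ) * y ^ (2 + δ))) (by
      intro s hs
      apply DifferentiableAt.differentiableWithinAt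
      have hne : s + 1 ≠ 0 := by
        intro h
        have := congrArg re h
        simp at this; linarith [hs.1]
      refine (hEd s hs.1).mul (DifferentiableAt.div (DifferentiableAt.sub ?_ ?_) (by fun_prop) hne)
      · exact DifferentiableAt.const_cpow (by fun_prop) (Or.inl (by exact_mod_cast hy0.ne'))
      · exact DifferentiableAt.const_cpow (by fun_prop) (Or.inl (by exact_mod_cast hx0.ne')))
    (by
      intro s h1 h2
      refine (hWb s h1).trans ?_
      have hyx : 0 ≤ (y - x) ^ (1 - δ) := Real.rpow_nonneg (by linarith) _
      gcongr
      exact hy1.le)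
  rw [← hshift] at hdiff
  have hn : ‖∫ t : ℝ, W (σ + t * I)‖ ≤ 4 * K * ((y - x) ^ (1 - δ) * y ^ (σ + δ)) * J := by
    rw [← integral_const_mul]
    refine norm_integral_le_of_norm_le ((integrable_vert_pow (by linarith)).const_mul _) ?_
    refine Eventually.of_forall fun t => ?_
    simpa using hWb (σ + t * I) (by simp)
  have h1 : |∫ u in x..y, A u| = ‖((∫ u in x..y, A u : ℝ) : ℂ)‖ := by
    rw [norm_real, Real.norm_eq_abs]
  rw [h1, hdiff, norm_mul]
  have h2 : ‖(1 / (2 * Real.pi) : ℂ)‖ = 1 / (2 * Real.pi) := by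
    have : (1 / (2 * Real.pi) : ℂ) = ((1 / (2 * Real.pi) : ℝ) : ℂ) := by push_cast; ring
    rw [this, norm_real, Real.norm_eq_abs, abs_of_nonneg (by positivity)]
  rw [h2]
  calc _ ≤ 1 / (2 * Real.pi) * (4 * K * ((y - x) ^ (1 - δ) * y ^ (σ + δ)) * J) := by gcongr
    _ = _ := by ring


/-- Tauberian theorem. -/
lemma tauber {A : ℝ → ℝ} {C D K δ σ : ℝ} (hA : Measurable A) (hC0 : 0 ≤ C)
    (hC : ∀ x, 1 ≤ x → |A x| ≤ C * x) {E : ℂ → ℂ} (hδ : 0 < δ) (hδ1 : δ < 1)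
    (hσ : 0 ≤ σ) (hσ1 : σ ≤ 1) (hD : 0 ≤ D)
    (hosc : ∀ x y, 1 ≤ x → x ≤ y → y ≤ 2 * x → A x - D * (y - x) - D * x ^ σ ≤ A y)
    (hEd : ∀ s : ℂ, σ ≤ s.re → DifferentiableAt ℂ E s)
    (hE : ∀ s : ℂ, 1 < s.re → E s = RM A s)
    (hK : ∀ s : ℂ, σ ≤ s.re → ‖E s‖ ≤ K * (1 + |s.im|) ^ (δ / 2 - 1)) :
    A =O[atTop] fun x => x ^ (σ + δ) := by
  obtain ⟨K', hK'0, hK'⟩ := prim_diff_bound hA hC0 hC hδ hδ1 hσ (by linarith) hEd hE hK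
  refine IsBigO.of_bound (2 * D + 2 * K' * 4) ?_
  filter_upwards [eventually_ge_atTop 3] with x hx
  have hx0 : 0 < x := by linarith
  have hxσ1 : 1 ≤ x ^ σ := Real.one_le_rpow (by linarith) hσ
  have hxσx : x ^ σ ≤ x := by
    calc x ^ σ ≤ x ^ (1:ℝ) := Real.rpow_le_rpow_of_exponent_le (by linarith) hσ1
      _ = x := by simp
  have hxσδ : x ^ σ ≤ x ^ (σ + δ) := Real.rpow_le_rpow_of_exponent_le (by linarith) (by linarith)
  set h := x ^ σ / 2 with hh
  have hh0 : 0 < h := by positivity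
  have hpow : h ^ (1 - δ) ≤ 2 * h := by
    rw [Real.rpow_sub hh0, Real.rpow_one, div_eq_mul_inv, ← Real.rpow_neg hh0.le, mul_comm]
    gcongr
    calc h ^ (-δ) ≤ (1/2 : ℝ) ^ (-δ) := by
          apply Real.rpow_le_rpow_of_nonpos (by norm_num) (by linarith) (by linarith)
      _ = 2 ^ δ := by rw [one_div, Real.inv_rpow (by norm_num), Real.rpow_neg (by norm_num), inv_inv]
      _ ≤ 2 ^ (1:ℝ) := Real.rpow_le_rpow_of_exponent_le (by norm_num) hδ1.le
      _ = 2 := by simp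
  have h2x : (2 * x) ^ (σ + δ) ≤ 4 * x ^ (σ + δ) := by
    rw [Real.mul_rpow (by norm_num) hx0.le]
    gcongr
    calc (2:ℝ) ^ (σ + δ) ≤ 2 ^ (2:ℝ) := Real.rpow_le_rpow_of_exponent_le (by norm_num) (by linarith)
      _ = 4 := by norm_num
  have key : ∀ z, 1 < z → z + h ≤ 2 * x → |∫ u in z..(z+h), A u| ≤ h * (2 * K' * 4 * x ^ (σ + δ)) := by
    intro z hz hzx
    refine (hK' z (z+h) hz (by linarith)).trans ?_
    have h1 : (z + h) ^ (σ + δ) ≤ (2*x) ^ (σ + δ) := by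
      apply Real.rpow_le_rpow (by linarith) hzx (by linarith)
    rw [add_sub_cancel_left]
    calc K' * (h ^ (1-δ) * (z+h) ^ (σ + δ)) ≤ K' * ((2 * h) * (4 * x ^ (σ + δ))) := by
          gcongr
          exact h1.trans h2x
      _ = _ := by ring
  have hnn : 0 ≤ x ^ (σ + δ) := by positivity
  rw [Real.norm_eq_abs, Real.norm_eq_abs, abs_of_nonneg hnn]
  have hup : A x ≤ (2 * D + 2 * K' * 4) * x ^ (σ + δ) := by
    have h1 : ∫ u in x..(x+h), (A x - 2 * D * x ^ σ) ≤ ∫ u in x..(x+h), A u := by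
      apply intervalIntegral.integral_mono_on (by linarith) (by simp)
        (intble_of_bound hA hC (by linarith) (by linarith))
      intro u hu
      have := hosc x u (by linarith) hu.1 (by linarith [hu.2])
      have h3 : D * (u - x) ≤ D * x ^ σ := by
        apply mul_le_mul_of_nonneg_left _ hD
        linarith [hu.2]
      linarith
    rw [intervalIntegral.integral_const, smul_eq_mul, add_sub_cancel_left] at h1
    have h2 := (le_abs_self _).trans (key x (by linarith) (by linarith))
    have h3 := le_of_mul_le_mul_left (h1.trans h2) hh0
    nlinarith
  have hlo : -((2 * D + 2 * K' * 4) * x ^ (σ + δ)) ≤ A x := by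
    have h1 : ∫ u in (x-h)..(x-h+h), A u ≤ ∫ u in (x-h)..(x-h+h), (A x + 2 * D * x ^ σ) := by
      apply intervalIntegral.integral_mono_on (by linarith)
        (intble_of_bound hA hC (by linarith) (by linarith)) (by simp)
      intro u hu
      have hu2 : u ≤ x := by linarith [hu.2]
      have := hosc u x (by linarith [hu.1]) hu2 (by linarith [hu.1])
      have h3 : D * (x - u) ≤ D * x ^ σ := by
        apply mul_le_mul_of_nonneg_left _ hD
        linarith [hu.1]
      have h4 : D * u ^ σ ≤ D * x ^ σ := by
        apply mul_le_mul_of_nonneg_left _ hD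
        exact Real.rpow_le_rpow (by linarith [hu.1]) hu2 hσ
      linarith
    rw [intervalIntegral.integral_const, smul_eq_mul, add_sub_cancel_left] at h1
    have h2 := (neg_le_neg (key (x-h) (by linarith) (by linarith))).trans (neg_abs_le _)
    have h3 := h2.trans h1
    rw [← mul_neg] at h3
    have h3 := le_of_mul_le_mul_left h3 hh0
    nlinarith
  exact abs_le.mpr ⟨hlo, hup⟩

end

section
open Set Complex

lemma isOpen_hp (σ : ℝ) : IsOpen {s : ℂ | σ < s.re} := isOpen_lt continuous_const continuous_re

lemma convex_hp (σ : ℝ) : Convex ℝ {s : ℂ | σ < s.re} := convex_halfSpace_re_gt σ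

lemma halfplane_primitive {σ : ℝ} {K : ℂ → ℂ} (hK : ∀ s : ℂ, σ < s.re → DifferentiableAt ℂ K s) :
    ∃ Φ : ℂ → ℂ, ∀ s : ℂ, σ < s.re → HasDerivAt Φ (K s) s := by
  set S : ℂ → ℂ := fun w => σ + (1 + w) / (1 - w) with hS
  have hne : ∀ w ∈ Metric.ball (0:ℂ) 1, 1 - w ≠ 0 := by
    intro w hw h
    rw [sub_eq_zero] at h
    rw [← h] at hw
    simp at hw
  have hSd : ∀ w ∈ Metric.ball (0:ℂ) 1, HasDerivAt S (2 / (1 - w) ^ 2) w := by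
    intro w hw
    have h1 : HasDerivAt (fun w : ℂ => 1 + w) 1 w := (hasDerivAt_id w).const_add 1
    have h2 : HasDerivAt (fun w : ℂ => 1 - w) (-1) w := (hasDerivAt_id w).const_sub 1
    have := (h1.div h2 (hne w hw)).const_add (σ : ℂ)
    refine this.congr_deriv ?_
    have := hne w hw
    field_simp; ring
  have hSre : ∀ w ∈ Metric.ball (0:ℂ) 1, σ < (S w).re := by
    intro w hw
    have hw1 : ‖w‖ < 1 := by simpa using hw
    have h1 : (S w).re = σ + (1 - normSq w) / normSq (1 - w) := by
      simp only [hS, add_re, ofReal_re, div_re, one_re, sub_re, add_im, one_im, sub_im]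
      have : normSq (1 - w) ≠ 0 := by simpa using hne w hw
      rw [← add_div]
      congr 2
      rw [normSq_apply]; ring
    rw [h1]
    have h2 : 0 < normSq (1 - w) := normSq_pos.mpr (hne w hw)
    have h3 : normSq w < 1 := by
      rw [normSq_eq_norm_sq]
      nlinarith [norm_nonneg w]
    have : 0 < (1 - normSq w) / normSq (1 - w) := div_pos (by linarith) h2
    linarith
  have hg : DifferentiableOn ℂ (fun w => K (S w) * (2 / (1 - w) ^ 2)) (Metric.ball 0 1) := by
    intro w hw
    apply DifferentiableAt.differentiableWithinAt
    apply DifferentiableAt.mul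
    · exact DifferentiableAt.comp w (hK _ (hSre w hw)) (hSd w hw).differentiableAt
    · have := hne w hw
      apply DifferentiableAt.div (by fun_prop) (by fun_prop)
      positivity
  obtain ⟨Ψ, hΨ⟩ := hg.isExactOn_ball
  refine ⟨fun s => Ψ ((s - σ - 1) / (s - σ + 1)), ?_⟩
  intro s hs
  have h0 : s - σ + 1 ≠ 0 := by
    intro h
    have := congrArg re h
    simp at this; linarith
  set w := (s - σ - 1) / (s - σ + 1) with hw
  have hwb : w ∈ Metric.ball (0:ℂ) 1 := by
    rw [mem_ball_zero_iff, hw, norm_div, div_lt_one (norm_pos_iff.mpr h0)]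
    rw [← sq_lt_sq₀ (norm_nonneg _) (norm_nonneg _), ← normSq_eq_norm_sq, ← normSq_eq_norm_sq,
      normSq_apply, normSq_apply]
    simp
    nlinarith
  have hSw : S w = s := by
    have h1w : 1 - w = 2 / (s - σ + 1) := by rw [hw]; field_simp; ring
    simp only [hS]
    rw [h1w, hw]; field_simp; ring
  have hwd : HasDerivAt (fun s : ℂ => (s - σ - 1) / (s - σ + 1)) (2 / (s - σ + 1) ^ 2) s := by
    have h1 : HasDerivAt (fun s : ℂ => s - σ - 1) 1 s := ((hasDerivAt_id s).sub_const _).sub_const 1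
    have h2 : HasDerivAt (fun s : ℂ => s - σ + 1) 1 s := ((hasDerivAt_id s).sub_const _).add_const 1
    refine (h1.div h2 h0).congr_deriv ?_
    field_simp; ring
  have := HasDerivAt.comp s (hΨ w hwb) hwd
  refine HasDerivAt.congr_deriv this ?_
  simp only []
  rw [hSw]
  have h1w : 1 - w = 2 / (s - σ + 1) := by rw [hw]; field_simp; ring
  rw [h1w]; field_simp

lemma const_of_deriv_zero {σ : ℝ} {f : ℂ → ℂ} (hf : ∀ s : ℂ, σ < s.re → HasDerivAt f 0 s) :
    ∃ c, ∀ s : ℂ, σ < s.re → f s = c := by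
  refine ⟨f (σ + 1), fun s hs => ?_⟩
  have hd : DifferentiableOn ℂ f {s | σ < s.re} := fun z hz => (hf z hz).differentiableAt.differentiableWithinAt
  refine (isOpen_hp σ).is_const_of_deriv_eq_zero (convex_hp σ).isPreconnected hd ?_ hs (by simp)
  intro z hz
  exact (hf z hz).deriv

lemma log_exists {σ : ℝ} {G : ℂ → ℂ} (hG : ∀ s : ℂ, σ < s.re → DifferentiableAt ℂ G s)
    (hG0 : ∀ s : ℂ, σ < s.re → G s ≠ 0) :
    ∃ L : ℂ → ℂ, ∀ s : ℂ, σ < s.re → HasDerivAt L (deriv G s / G s) s ∧ exp (L s) = G s := by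
  have hGd : DifferentiableOn ℂ G {s | σ < s.re} := fun z hz => (hG z hz).differentiableWithinAt
  have hd := hGd.deriv (isOpen_hp σ)
  obtain ⟨Φ, hΦ⟩ := halfplane_primitive (σ := σ) (K := fun s => deriv G s / G s) (fun s hs =>
    (hd.differentiableAt ((isOpen_hp σ).mem_nhds hs)).div (hG s hs) (hG0 s hs))
  obtain ⟨c, hc⟩ := const_of_deriv_zero (σ := σ) (f := fun s => G s * exp (-Φ s)) (by
    intro s hs
    have h1 := (hG s hs).hasDerivAt.mul ((hΦ s hs).neg.cexp)
    refine h1.congr_deriv ?_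
    have := hG0 s hs
    field_simp; ring)
  have hc0 : c ≠ 0 := by
    rw [← hc (σ + 1) (by simp)]
    exact mul_ne_zero (hG0 _ (by simp)) (exp_ne_zero _)
  refine ⟨fun s => Φ s + log c, fun s hs => ⟨(hΦ s hs).add_const _, ?_⟩⟩
  rw [exp_add, exp_log hc0, ← hc s hs, exp_neg]
  field_simp

lemma norm_log_le_of_near {z : ℂ} (hz : ‖z - 1‖ ≤ 1 / 2) : ‖log z‖ ≤ 1 + Real.pi := by
  have h1 : 1 / 2 ≤ ‖z‖ := by
    have := norm_sub_norm_le (1:ℂ) (1 - z)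
    rw [norm_sub_rev 1 z] at this
    simp at this; linarith
  have h2 : ‖z‖ ≤ 3 / 2 := by
    have := norm_add_le (z - 1) 1
    simp at this; linarith
  refine (norm_le_abs_re_add_abs_im _).trans ?_
  rw [log_re, log_im]
  refine add_le_add ?_ (abs_arg_le_pi z)
  rw [abs_le]
  constructor
  · have := Real.one_sub_inv_le_log_of_pos (x := ‖z‖) (by linarith)
    have h3 : ‖z‖⁻¹ ≤ (1/2 : ℝ)⁻¹ := by gcongr
    norm_num at h3
    linarith
  · have := Real.log_le_sub_one_of_pos (x := ‖z‖) (by linarith)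
    linarith

lemma L_bdd {σ b : ℝ} {G L : ℂ → ℂ} (hb : σ ≤ b)
    (hG : ∀ s : ℂ, σ < s.re → DifferentiableAt ℂ G s)
    (hL : ∀ s : ℂ, σ < s.re → HasDerivAt L (deriv G s / G s) s ∧ exp (L s) = G s)
    (hGb : ∀ s : ℂ, b < s.re → ‖G s - 1‖ ≤ 1 / 2) :
    ∃ B : ℝ, 1 ≤ B ∧ ∀ s : ℂ, b < s.re → ‖L s‖ ≤ B := by
  obtain ⟨c, hc⟩ := const_of_deriv_zero (σ := b) (f := fun s => L s - log (G s)) (by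
    intro s hs
    have hs' := hb.trans_lt hs
    have hsl : G s ∈ slitPlane := by
      left
      have := (abs_re_le_norm (G s - 1)).trans (hGb s hs)
      rw [abs_le] at this
      simp at this; linarith [this.1]
    have := (hL s hs').1.sub ((hG s hs').hasDerivAt.clog hsl)
    exact this.congr_deriv (sub_self _))
  refine ⟨1 + Real.pi + ‖c‖, by linarith [Real.pi_pos, norm_nonneg c], fun s hs => ?_⟩
  have h1 := hc s hs
  have h2 : L s = log (G s) + c := by rw [← h1]; ring
  rw [h2]
  exact (norm_add_le _ _).trans (by gcongr; exact norm_log_le_of_near (hGb s hs))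

lemma one_le_ell (t : ℝ) : 1 ≤ Real.log (3 + |t|) := by
  rw [Real.le_log_iff_exp_le (by positivity)]
  have := Real.exp_one_lt_d9
  linarith [abs_nonneg t]

lemma ell_le (t u : ℝ) : Real.log (3 + |u|) ≤ Real.log (3 + |t|) + |u - t| := by
  have h1 : 3 + |u| ≤ (3 + |t|) * (1 + |u - t|) := by
    have : |u| ≤ |t| + |u - t| := by
      have := abs_add_le t (u - t); simpa using this
    nlinarith [abs_nonneg t, abs_nonneg (u - t)]
  calc Real.log (3 + |u|) ≤ Real.log ((3 + |t|) * (1 + |u - t|)) := by gcongr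
    _ = Real.log (3 + |t|) + Real.log (1 + |u - t|) := Real.log_mul (by positivity) (by positivity)
    _ ≤ _ := by
      gcongr
      have := Real.log_le_sub_one_of_pos (x := 1 + |u - t|) (by positivity)
      linarith

lemma L_log {σ b σ₁ B C : ℝ} {G L : ℂ → ℂ} (hσ₁ : σ < σ₁)
    (hL : ∀ s : ℂ, σ < s.re → HasDerivAt L (deriv G s / G s) s ∧ exp (L s) = G s)
    (hB1 : 1 ≤ B) (hB : ∀ s : ℂ, b < s.re → ‖L s‖ ≤ B)
    (hC : ∀ s : ℂ, (σ + σ₁) / 2 ≤ s.re → ‖G s‖ ≤ C * (1 + ‖s‖)) :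
    ∃ D : ℝ, 1 ≤ D ∧ ∀ s : ℂ, σ₁ ≤ s.re → ‖L s‖ ≤ D * Real.log (3 + |s.im|) := by
  set c := max b σ₁ + 1 with hc
  have hbc : b < c := by linarith [le_max_left b σ₁]
  have hcσ : σ₁ < c := by linarith [le_max_right b σ₁]
  set R := c - (σ + σ₁) / 2 with hR
  set r := c - σ₁ with hr
  have hrR : r < R := by simp only [hR, hr]; linarith
  have hr0 : 0 < r := by linarith
  have hR0 : 0 < R := by linarith
  set C' := max C 1 * (1 + |c| + R) with hC'
  have hC'1 : 1 ≤ C' := by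
    have h1 : 1 ≤ max C 1 := le_max_right _ _
    have h2 : 1 ≤ 1 + |c| + R := by linarith [abs_nonneg c]
    nlinarith
  have hlogC' : 0 ≤ Real.log C' := Real.log_nonneg hC'1
  set m := 1 + Real.log C' with hm
  refine ⟨(2 * m * R + B * (2 * R)) / (R - r) + B, ?_, ?_⟩
  · have : 0 ≤ (2 * m * R + B * (2 * R)) / (R - r) := by
      apply div_nonneg <;> [positivity; linarith]
    linarith
  intro s hs
  have hl := one_le_ell s.im
  set l := Real.log (3 + |s.im|) with hldef
  have hq : 0 ≤ (2 * m * R + B * (2 * R)) / (R - r) := by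
    apply div_nonneg <;> [positivity; linarith]
  by_cases hsc : c ≤ s.re
  · have := hB s (by linarith)
    nlinarith
  push Not at hsc
  set z : ℂ := ((s.re - c : ℝ) : ℂ) with hz
  have hzn : ‖z‖ = c - s.re := by
    rw [hz, norm_real, Real.norm_eq_abs, abs_of_neg (by linarith)]; ring
  have hzr : ‖z‖ ≤ r := by rw [hzn]; linarith
  set p : ℂ := c + s.im * I with hp
  have hpre : p.re = c := by simp [hp]
  have hre : ∀ w ∈ Metric.ball (0:ℂ) R, (σ + σ₁) / 2 < (p + w).re := by
    intro w hw
    rw [mem_ball_zero_iff] at hw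
    have := (abs_le.mp (abs_re_le_norm w)).1
    rw [add_re, hpre]; linarith
  have hM : 0 < m * l := by positivity
  have hbc2 := borelCaratheodory (f := fun w => L (p + w)) (M := m * l) (R := R) (z := z) hM ?_ ?_ hR0
    (by rw [mem_ball_zero_iff]; linarith)
  · have hpz : p + z = s := by
      apply Complex.ext <;> simp [hp, hz]
    simp only [hpz, add_zero] at hbc2
    have hLp : ‖L p‖ ≤ B := hB p (by rw [hpre]; exact hbc)
    refine hbc2.trans ?_
    rw [← add_div]
    have hd : 0 < R - r := by linarith
    have hz0 := norm_nonneg z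
    calc (2 * (m * l) * ‖z‖ + ‖L p‖ * (R + ‖z‖)) / (R - ‖z‖)
        ≤ (2 * (m * l) * R + (B * l) * (R + R)) / (R - r) := by
          gcongr
          · linarith
          · nlinarith
          · linarith
      _ = (2 * m * R + B * (2 * R)) / (R - r) * l := by ring
      _ ≤ _ := by nlinarith
  · intro w hw
    apply DifferentiableAt.differentiableWithinAt
    refine DifferentiableAt.comp w (hL (p + w) (by linarith [hre w hw])).1.differentiableAt (by fun_prop)
  · intro w hw
    have hre' := hre w hw
    have h1 := hC (p + w) hre'.le
    rw [← (hL (p + w) (by linarith)).2, norm_exp] at h1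
    rw [mem_ball_zero_iff] at hw
    have h2 : ‖p + w‖ ≤ |c| + |s.im| + R := by
      refine (norm_add_le _ _).trans ?_
      have : ‖p‖ ≤ |c| + |s.im| := by
        refine (norm_le_abs_re_add_abs_im p).trans ?_
        simp [hp]
      linarith
    have h3 : Real.exp ((L (p + w)).re) ≤ C' * (3 + |s.im|) := by
      refine h1.trans ?_
      have h4 : 1 ≤ max C 1 := le_max_right _ _
      have h5 : 1 + ‖p + w‖ ≤ (1 + |c| + R) * (3 + |s.im|) := by
        nlinarith [abs_nonneg c, abs_nonneg s.im]
      calc C * (1 + ‖p + w‖) ≤ max C 1 * (1 + ‖p + w‖) := by gcongr; exact le_max_left _ _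
        _ ≤ max C 1 * ((1 + |c| + R) * (3 + |s.im|)) := by gcongr
        _ = _ := by ring
    have h6 := (Real.le_log_iff_exp_le (by positivity)).mpr h3
    rw [Real.log_mul (by linarith) (by positivity)] at h6
    simp only [mem_ofPred_eq]
    refine h6.trans ?_
    rw [hm]
    nlinarith

lemma L_deriv {σ σ₁ D : ℝ} {G L : ℂ → ℂ} (hσ₁ : σ < σ₁)
    (hL : ∀ s : ℂ, σ < s.re → HasDerivAt L (deriv G s / G s) s ∧ exp (L s) = G s)
    (hD1 : 1 ≤ D)
    (hD : ∀ s : ℂ, (σ + σ₁) / 2 ≤ s.re → ‖L s‖ ≤ D * Real.log (3 + |s.im|)) :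
    ∃ D' : ℝ, 0 ≤ D' ∧ ∀ s : ℂ, σ₁ ≤ s.re → ‖deriv G s / G s‖ ≤ D' * Real.log (3 + |s.im|) := by
  set r := (σ₁ - σ) / 2 with hr
  have hr0 : 0 < r := by simp only [hr]; linarith
  refine ⟨D * (1 + r) / r, by positivity, fun s hs => ?_⟩
  rw [← (hL s (by linarith)).1.deriv]
  have hl := one_le_ell s.im
  have hcb : ∀ z ∈ Metric.closedBall s r, (σ + σ₁) / 2 ≤ z.re ∧ |z.im - s.im| ≤ r := by
    intro z hz
    rw [mem_closedBall_iff_norm] at hz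
    have h1 := (abs_re_le_norm (z - s)).trans hz
    have h2 := (abs_im_le_norm (z - s)).trans hz
    rw [sub_re, abs_le] at h1
    rw [sub_im] at h2
    exact ⟨by linarith [h1.1], h2⟩
  have := norm_deriv_le_of_forall_mem_sphere_norm_le (f := L) (c := s) (R := r)
    (C := D * (1 + r) * Real.log (3 + |s.im|)) hr0 ?_ ?_
  · exact this.trans_eq (by ring)
  · apply DifferentiableOn.diffContOnCl
    rw [closure_ball s hr0.ne']
    intro z hz
    exact (hL z (by linarith [(hcb z hz).1])).1.differentiableAt.differentiableWithinAt
  · intro z hz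
    have h1 := hcb z (Metric.sphere_subset_closedBall hz)
    refine (hD z h1.1).trans ?_
    have h2 := ell_le s.im z.im
    have h3 : Real.log (3 + |z.im|) ≤ (1 + r) * Real.log (3 + |s.im|) := by nlinarith [h1.2]
    rw [mul_assoc]
    gcongr

end

section
open Set Complex

lemma abs_mul_exp_neg_sq_le (y : ℝ) : |y| * Real.exp (-y ^ 2) ≤ 1 := by
  rw [Real.exp_neg, ← div_eq_mul_inv, div_le_one (Real.exp_pos _)]
  have h1 := Real.add_one_le_exp (y ^ 2)
  have h2 := sq_abs y
  nlinarith [sq_nonneg (|y| - 1), abs_nonneg y]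

lemma L_three {σ₁ σ b B D : ℝ} {L : ℂ → ℂ} (h0 : 0 ≤ σ₁) (hσ : σ₁ < σ)
    (hL : ∀ s : ℂ, σ₁ ≤ s.re → DifferentiableAt ℂ L s)
    (hB1 : 1 ≤ B) (hB : ∀ s : ℂ, b < s.re → ‖L s‖ ≤ B) (hD1 : 1 ≤ D)
    (hD : ∀ s : ℂ, σ₁ ≤ s.re → ‖L s‖ ≤ D * Real.log (3 + |s.im|)) :
    ∃ C u : ℝ, 1 ≤ C ∧ 0 < u ∧ u < 1 ∧ ∀ s : ℂ, σ ≤ s.re →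
      ‖L s‖ ≤ C * (2 * D * Real.log (3 + |s.im|)) ^ (1 - u) := by
  set c := max b σ + 1 with hc
  have hbc : b < c := by linarith [le_max_left b σ]
  have hcσ : σ < c := by linarith [le_max_right b σ]
  set Q := Real.exp (c ^ 2) with hQ
  have hQ1 : 1 ≤ Q := Real.one_le_exp (sq_nonneg c)
  have hcσ1 : 0 < c - σ₁ := by linarith
  refine ⟨B * Q, (σ - σ₁) / (c - σ₁), by nlinarith, by apply div_pos <;> linarith,
    by rw [div_lt_one hcσ1]; linarith, ?_⟩
  intro s hs
  have hl := one_le_ell s.im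
  set l := Real.log (3 + |s.im|) with hldef
  set X := 2 * D * l with hX
  have hX1 : 1 ≤ X := by nlinarith
  set u := (σ - σ₁) / (c - σ₁) with hu
  have hu1 : u < 1 := by rw [hu, div_lt_one hcσ1]; linarith
  have hX2 : 1 ≤ X ^ (1 - u) := Real.one_le_rpow hX1 (by linarith)
  have hBQ : B ≤ B * Q := by nlinarith
  by_cases hsc : c < s.re
  · have := hB s (by linarith)
    nlinarith
  push Not at hsc
  set f : ℂ → ℂ := fun z => L z * exp ((z - s.im * I) ^ 2) with hf
  have hexp : ∀ z : ℂ, ‖exp ((z - s.im * I) ^ 2)‖ = Real.exp (z.re ^ 2) * Real.exp (-(z.im - s.im) ^ 2) := by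
    intro z
    rw [norm_exp, ← Real.exp_add]
    congr 1
    simp [sq]
    ring
  have hexp2 : ∀ z : ℂ, σ₁ ≤ z.re → z.re ≤ c →
      ‖exp ((z - s.im * I) ^ 2)‖ ≤ Q * Real.exp (-(z.im - s.im) ^ 2) := by
    intro z h1 h2
    rw [hexp, hQ]
    gcongr
    linarith
  have hf1 : ∀ z : ℂ, σ₁ ≤ z.re → z.re ≤ c → ‖f z‖ ≤ B * Q * X := by
    intro z h1 h2
    have h3 : Real.log (3 + |z.im|) * Real.exp (-(z.im - s.im) ^ 2) ≤ 2 * l := by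
      have h4 := ell_le s.im z.im
      have h5 := abs_mul_exp_neg_sq_le (z.im - s.im)
      have h6 : Real.exp (-(z.im - s.im) ^ 2) ≤ 1 := by
        rw [Real.exp_le_one_iff]; nlinarith [sq_nonneg (z.im - s.im)]
      have h7 := Real.exp_pos (-(z.im - s.im) ^ 2)
      calc Real.log (3 + |z.im|) * Real.exp (-(z.im - s.im) ^ 2)
          ≤ (l + |z.im - s.im|) * Real.exp (-(z.im - s.im) ^ 2) := by gcongr
        _ = l * Real.exp (-(z.im - s.im) ^ 2) + |z.im - s.im| * Real.exp (-(z.im - s.im) ^ 2) := by ring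
        _ ≤ 2 * l := by nlinarith
    calc ‖f z‖ = ‖L z‖ * ‖exp ((z - s.im * I) ^ 2)‖ := by rw [hf]; exact norm_mul _ _
      _ ≤ (D * Real.log (3 + |z.im|)) * (Q * Real.exp (-(z.im - s.im) ^ 2)) := by
          gcongr
          · have := one_le_ell z.im; positivity
          · exact hD z h1
          · exact hexp2 z h1 h2
      _ = D * Q * (Real.log (3 + |z.im|) * Real.exp (-(z.im - s.im) ^ 2)) := by ring
      _ ≤ D * Q * (2 * l) := by gcongr
      _ = 1 * (Q * X) := by rw [hX]; ring
      _ ≤ B * (Q * X) := by gcongr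
      _ = _ := by ring
  have hf2 : ∀ z : ℂ, z.re = c → ‖f z‖ ≤ B * Q := by
    intro z h1
    calc ‖f z‖ = ‖L z‖ * ‖exp ((z - s.im * I) ^ 2)‖ := by rw [hf]; exact norm_mul _ _
      _ ≤ B * (Q * Real.exp (-(z.im - s.im) ^ 2)) := by
          gcongr
          · exact hB z (by linarith)
          · exact hexp2 z (by linarith) (by linarith)
      _ ≤ B * (Q * 1) := by
          gcongr
          rw [Real.exp_le_one_iff]; nlinarith [sq_nonneg (z.im - s.im)]
      _ = _ := by ring
  have key := Complex.HadamardThreeLines.norm_le_interp_of_mem_verticalClosedStrip'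
    (f := f) (z := s) (l := σ₁) (u := c) (a := B * Q * X) (b := B * Q) (by linarith)
    (by
      simp only [HadamardThreeLines.verticalClosedStrip, mem_preimage, mem_Icc]
      constructor <;> linarith) ?_ ?_ ?_ ?_
  · have h1 : ‖L s‖ ≤ ‖f s‖ := by
      have : f s = L s * exp ((s - s.im * I) ^ 2) := rfl
      rw [this, norm_mul, hexp]
      simp only [sub_self]
      have h2 : 1 ≤ Real.exp (s.re ^ 2) := Real.one_le_exp (sq_nonneg _)
      norm_num
      nlinarith [norm_nonneg (L s)]
    refine h1.trans (key.trans ?_)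
    set v := (s.re - σ₁) / (c - σ₁) with hv
    have huv : u ≤ v := by rw [hu, hv]; gcongr
    have hBQ0 : 0 < B * Q := by positivity
    have hX0 : 0 < X := by linarith
    rw [Real.mul_rpow hBQ0.le hX0.le, mul_right_comm, ← Real.rpow_add hBQ0, sub_add_cancel, Real.rpow_one]
    gcongr
  · apply DifferentiableOn.diffContOnCl
    intro z hz
    have hz' : σ₁ ≤ z.re := by
      have : closure (HadamardThreeLines.verticalStrip σ₁ c) ⊆ {z : ℂ | σ₁ ≤ z.re} :=
        closure_minimal (fun w hw => by
          simp only [HadamardThreeLines.verticalStrip, mem_preimage, mem_Ioo] at hw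
          exact hw.1.le) (isClosed_le continuous_const continuous_re)
      exact this hz
    apply DifferentiableAt.differentiableWithinAt
    exact (hL z hz').mul (by fun_prop)
  · refine ⟨B * Q * X, ?_⟩
    rintro _ ⟨z, hz, rfl⟩
    simp only [HadamardThreeLines.verticalClosedStrip, mem_preimage, mem_Icc] at hz
    exact hf1 z hz.1 hz.2
  · intro z hz
    simp only [mem_preimage, mem_singleton_iff] at hz
    exact hf1 z (by linarith) (by linarith)
  · intro z hz
    simp only [mem_preimage, mem_singleton_iff] at hz
    exact hf2 z hz

lemma rpow_small {C u η X : ℝ} (hC : 1 ≤ C) (hu : 0 < u) (hη : 0 < η) (hX : 1 ≤ X) :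
    C * X ^ (1 - u) ≤ η * X + C * (C / η) ^ (1 / u) := by
  have hX0 : 0 < X := by linarith
  rw [Real.rpow_sub hX0, Real.rpow_one]
  have hXu : 0 < X ^ u := Real.rpow_pos_of_pos hX0 u
  have hCη : 0 < C / η := by positivity
  have hp : 0 < (C / η) ^ (1 / u) := Real.rpow_pos_of_pos hCη _
  by_cases h : C / η ≤ X ^ u
  · have : C * (X / X ^ u) ≤ η * X := by
      rw [div_le_iff₀ hη] at h
      rw [← mul_div_assoc, div_le_iff₀ hXu]
      nlinarith
    nlinarith
  · push Not at h
    have h1 : X ≤ (C / η) ^ (1 / u) := by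
      have := Real.rpow_le_rpow hXu.le h.le (z := 1 / u) (by positivity)
      rwa [← Real.rpow_mul hX0.le, mul_one_div_cancel hu.ne', Real.rpow_one] at this
    have h2 : X / X ^ u ≤ X := div_le_self hX0.le (Real.one_le_rpow hX hu.le)
    have h3 : C * (X / X ^ u) ≤ C * (C / η) ^ (1 / u) := by gcongr; linarith
    nlinarith

lemma L_small {σ₁ σ b B D ε : ℝ} {L : ℂ → ℂ} (h0 : 0 ≤ σ₁) (hσ : σ₁ < σ) (hε : 0 < ε)
    (hL : ∀ s : ℂ, σ₁ ≤ s.re → DifferentiableAt ℂ L s)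
    (hB1 : 1 ≤ B) (hB : ∀ s : ℂ, b < s.re → ‖L s‖ ≤ B) (hD1 : 1 ≤ D)
    (hD : ∀ s : ℂ, σ₁ ≤ s.re → ‖L s‖ ≤ D * Real.log (3 + |s.im|)) :
    ∃ C : ℝ, 0 ≤ C ∧ ∀ s : ℂ, σ ≤ s.re → ‖exp (-L s)‖ ≤ C * (1 + |s.im|) ^ ε := by
  obtain ⟨C, u, hC1, hu, hu1, H⟩ := L_three h0 hσ hL hB1 hB hD1 hD
  set K := C * (C / (ε / (2 * D))) ^ (1 / u) with hK
  refine ⟨Real.exp K * 3 ^ ε, by positivity, fun s hs => ?_⟩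
  have hl := one_le_ell s.im
  have h1 := H s hs
  have h2 := rpow_small (X := 2 * D * Real.log (3 + |s.im|)) (η := ε / (2 * D)) hC1 hu (by positivity) (by nlinarith)
  have h3 : ε / (2 * D) * (2 * D * Real.log (3 + |s.im|)) = ε * Real.log (3 + |s.im|) := by
    field_simp
  rw [h3, ← hK] at h2
  rw [norm_exp]
  have h4 : (-L s).re ≤ ε * Real.log (3 + |s.im|) + K :=
    ((le_abs_self _).trans (abs_re_le_norm _)).trans ((norm_neg _).trans_le (h1.trans h2))
  have h5 : (0:ℝ) < 3 + |s.im| := by positivity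
  calc Real.exp (-L s).re ≤ Real.exp (ε * Real.log (3 + |s.im|) + K) := Real.exp_le_exp.mpr h4
    _ = (3 + |s.im|) ^ ε * Real.exp K := by
        rw [Real.exp_add, Real.rpow_def_of_pos h5, mul_comm ε]
    _ ≤ (3 * (1 + |s.im|)) ^ ε * Real.exp K := by
        gcongr; linarith [abs_nonneg s.im]
    _ = _ := by
        rw [Real.mul_rpow (by norm_num) (by positivity)]; ring

lemma ell_small {ε : ℝ} (hε : 0 < ε) : ∃ C : ℝ, 0 ≤ C ∧ ∀ t : ℝ, Real.log (3 + |t|) ≤ C * (1 + |t|) ^ ε := by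
  refine ⟨3 ^ ε / ε, by positivity, fun t => ?_⟩
  have h := Real.log_le_rpow_div (x := 3 + |t|) (by positivity) hε
  refine h.trans ?_
  rw [div_mul_eq_mul_div, ← Real.mul_rpow (by norm_num) (by positivity)]
  gcongr
  linarith [abs_nonneg t]

end

section
open Set Complex

/-- analytic hypotheses on G -/
structure GoodG (G : ℂ → ℂ) (σ₀ : ℝ) : Prop where
  nn : 0 ≤ σ₀
  diff : ∀ s : ℂ, σ₀ < s.re → DifferentiableAt ℂ G s
  ne : ∀ s : ℂ, σ₀ < s.re → G s ≠ 0
  bd : ∀ σ₁, σ₀ < σ₁ → ∃ C : ℝ, ∀ s : ℂ, σ₁ ≤ s.re → ‖G s‖ ≤ C * (1 + ‖s‖)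
  near : ∃ b, ∀ s : ℂ, b < s.re → ‖G s - 1‖ ≤ 1 / 2

lemma GoodG.bounds {G : ℂ → ℂ} {σ₀ σ ε : ℝ} (h : GoodG G σ₀) (hσ : σ₀ < σ) (hε : 0 < ε) :
    ∃ C : ℝ, 0 ≤ C ∧ ∀ s : ℂ, σ ≤ s.re → ‖(G s)⁻¹‖ ≤ C * (1 + |s.im|) ^ ε ∧
      ‖deriv G s / G s‖ ≤ C * (1 + |s.im|) ^ ε := by
  obtain ⟨L, hL⟩ := log_exists h.diff h.ne
  obtain ⟨b', hb'⟩ := h.near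
  set b := max b' σ₀ with hb
  obtain ⟨B, hB1, hB⟩ := L_bdd (b := b) (le_max_right _ _) h.diff hL
    (fun s hs => hb' s (lt_of_le_of_lt (le_max_left _ _) hs))
  set σ₁ := (σ₀ + σ) / 2 with hσ₁
  have h01 : σ₀ < σ₁ := by simp only [hσ₁]; linarith
  have h1σ : σ₁ < σ := by simp only [hσ₁]; linarith
  obtain ⟨C, hC⟩ := h.bd ((σ₀ + σ₁) / 2) (by linarith)
  obtain ⟨D, hD1, hD⟩ := L_log h01 hL hB1 hB hC
  obtain ⟨D', hD'0, hD'⟩ := L_deriv hσ hL hD1 hD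
  obtain ⟨C1, hC10, hC1⟩ := L_small (h.nn.trans h01.le) h1σ hε
    (fun s hs => (hL s (by linarith)).1.differentiableAt) hB1 hB hD1 hD
  obtain ⟨C2, hC20, hC2⟩ := ell_small hε
  refine ⟨C1 + D' * C2, by positivity, fun s hs => ⟨?_, ?_⟩⟩
  · rw [← (hL s (by linarith)).2, ← exp_neg]
    refine (hC1 s hs).trans ?_
    gcongr
    linarith [mul_nonneg hD'0 hC20]
  · refine (hD' s hs).trans ?_
    calc D' * Real.log (3 + |s.im|) ≤ D' * (C2 * (1 + |s.im|) ^ ε) := by gcongr; exact hC2 _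
      _ = D' * C2 * (1 + |s.im|) ^ ε := by ring
      _ ≤ _ := by gcongr; linarith

lemma inv_norm_le {σ : ℝ} (hσ : 0 < σ) {s : ℂ} (hs : σ ≤ s.re) :
    ‖s‖⁻¹ ≤ (1 + 1 / σ) * (1 + |s.im|) ^ (-1 : ℝ) ∧ ‖s‖⁻¹ ≤ 1 / σ := by
  have h1 : σ ≤ ‖s‖ := hs.trans ((le_abs_self _).trans (abs_re_le_norm s))
  have h2 : |s.im| ≤ ‖s‖ := abs_im_le_norm s
  have h3 : 0 < ‖s‖ := by linarith
  constructor
  · rw [Real.rpow_neg_one, ← div_eq_mul_inv, le_div_iff₀ (by positivity), inv_mul_le_iff₀ h3]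
    have : 1 ≤ ‖s‖ * (1 / σ) := by
      rw [mul_one_div, le_div_iff₀ hσ]; linarith
    linarith
  · rw [one_div]; gcongr

lemma main_M {G : ℂ → ℂ} {σ₀ σ δ : ℝ} (h : GoodG G σ₀) (hσ : σ₀ < σ) (hσ1 : σ ≤ 1)
    (hδ : 0 < δ) (hδ1 : δ < 1) {A : ℝ → ℝ} {C D : ℝ} (hA : Measurable A) (hC0 : 0 ≤ C)
    (hC : ∀ x, 1 ≤ x → |A x| ≤ C * x) (hD : 0 ≤ D)
    (hosc : ∀ x y, 1 ≤ x → x ≤ y → y ≤ 2 * x → A x - D * (y - x) - D * x ^ σ ≤ A y)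
    (hE : ∀ s : ℂ, 1 < s.re → (s - 1) / (s ^ 2 * G s) = RM A s) :
    A =O[atTop] fun x => x ^ (σ + δ) := by
  have hσ0 : 0 < σ := h.nn.trans_lt hσ
  obtain ⟨K, hK0, hK⟩ := h.bounds hσ (half_pos hδ)
  have hs0 : ∀ s : ℂ, σ ≤ s.re → s ≠ 0 := by
    rintro s hs rfl; simp at hs; linarith
  refine tauber (E := fun s => (s - 1) / (s ^ 2 * G s)) (K := (1 + 1 / σ) ^ 2 * K) hA hC0 hC hδ hδ1
    hσ0.le hσ1 hD hosc ?_ hE ?_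
  · intro s hs
    have := hs0 s hs
    have := h.ne s (by linarith)
    have := h.diff s (by linarith)
    apply DifferentiableAt.div (by fun_prop) (by fun_prop)
    positivity
  · intro s hs
    have h0 := hs0 s hs
    have h1 := inv_norm_le hσ0 hs
    have hn : 0 < ‖s‖ := norm_pos_iff.mpr h0
    have h2 : ‖(s - 1) / s‖ ≤ 1 + 1 / σ := by
      rw [sub_div, div_self h0]
      refine (norm_sub_le _ _).trans ?_
      rw [norm_one, norm_div, norm_one, one_div]
      linarith [h1.2]
    have h3 : (s - 1) / (s ^ 2 * G s) = ((s - 1) / s) * s⁻¹ * (G s)⁻¹ := by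
      have := h.ne s (by linarith)
      field_simp
    calc ‖(s - 1) / (s ^ 2 * G s)‖ = ‖(s - 1) / s‖ * ‖s‖⁻¹ * ‖(G s)⁻¹‖ := by
          rw [h3, norm_mul, norm_mul, norm_inv s]
      _ ≤ (1 + 1 / σ) * ((1 + 1 / σ) * (1 + |s.im|) ^ (-1 : ℝ)) * (K * (1 + |s.im|) ^ (δ / 2)) := by
          gcongr
          · exact h1.1
          · exact (hK s hs).1
      _ = (1 + 1 / σ) ^ 2 * K * (1 + |s.im|) ^ (δ / 2 - 1) := by
          rw [show δ / 2 - 1 = δ / 2 + (-1 : ℝ) by ring, Real.rpow_add (by positivity)]; ring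

lemma main_psi {G : ℂ → ℂ} {σ₀ σ δ : ℝ} (h : GoodG G σ₀) (hσ : σ₀ < σ) (hσ1 : σ ≤ 1)
    (hδ : 0 < δ) (hδ1 : δ < 1) {A : ℝ → ℝ} {C D : ℝ} (hA : Measurable A) (hC0 : 0 ≤ C)
    (hC : ∀ x, 1 ≤ x → |A x| ≤ C * x) (hD : 0 ≤ D)
    (hosc : ∀ x y, 1 ≤ x → x ≤ y → y ≤ 2 * x → A x - D * (y - x) - D * x ^ σ ≤ A y)
    (hE : ∀ s : ℂ, 1 < s.re → -(deriv G s / G s + 1 + 1 / s) / s = RM A s) :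
    A =O[atTop] fun x => x ^ (σ + δ) := by
  have hσ0 : 0 < σ := h.nn.trans_lt hσ
  obtain ⟨K, hK0, hK⟩ := h.bounds hσ (half_pos hδ)
  have hs0 : ∀ s : ℂ, σ ≤ s.re → s ≠ 0 := by
    rintro s hs rfl; simp at hs; linarith
  have hGd : DifferentiableOn ℂ G {s | σ₀ < s.re} := fun z hz => (h.diff z hz).differentiableWithinAt
  have hd := hGd.deriv (isOpen_hp σ₀)
  refine tauber (E := fun s => -(deriv G s / G s + 1 + 1 / s) / s) (K := (1 + 1 / σ) * (K + (1 + 1 / σ)))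
    hA hC0 hC hδ hδ1 hσ0.le hσ1 hD hosc ?_ hE ?_
  · intro s hs
    have h1 := hs0 s hs
    have h2 := h.ne s (by linarith)
    have h3 := h.diff s (by linarith)
    have h4 := hd.differentiableAt ((isOpen_hp σ₀).mem_nhds (show σ₀ < s.re by linarith))
    exact ((((h4.div h3 h2).add_const _).add ((differentiableAt_const _).div differentiableAt_id h1)).neg).div
      differentiableAt_id h1
  · intro s hs
    have h0 := hs0 s hs
    have h1 := inv_norm_le hσ0 hs
    have hn : 0 < ‖s‖ := norm_pos_iff.mpr h0
    have hp : 1 ≤ (1 + |s.im|) ^ (δ / 2) := Real.one_le_rpow (by linarith [abs_nonneg s.im]) (by positivity)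
    have h2 : ‖-(deriv G s / G s + 1 + 1 / s)‖ ≤ (K + (1 + 1 / σ)) * (1 + |s.im|) ^ (δ / 2) := by
      rw [norm_neg]
      have h3 := norm_add₃_le (a := deriv G s / G s) (b := 1) (c := 1 / s)
      rw [norm_one, norm_div 1 s, norm_one, one_div ‖s‖] at h3
      have h4 := (hK s hs).2
      have h5 : 0 < 1 + 1 / σ := by positivity
      nlinarith [h1.2]
    calc ‖-(deriv G s / G s + 1 + 1 / s) / s‖ = ‖-(deriv G s / G s + 1 + 1 / s)‖ * ‖s‖⁻¹ := by
          rw [norm_div, div_eq_mul_inv]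
      _ ≤ ((K + (1 + 1 / σ)) * (1 + |s.im|) ^ (δ / 2)) * ((1 + 1 / σ) * (1 + |s.im|) ^ (-1 : ℝ)) := by
          gcongr
          exact h1.1
      _ = (1 + 1 / σ) * (K + (1 + 1 / σ)) * (1 + |s.im|) ^ (δ / 2 - 1) := by
          rw [show δ / 2 - 1 = δ / 2 + (-1 : ℝ) by ring, Real.rpow_add (by positivity)]; ring

end

section
open MeasureTheory Set Complex

variable {ι : Type*} {n a : ι → ℝ} {C : ℝ}

lemma int_ind_real (m c σ : ℝ) (hm : 1 ≤ m) (hσ : 1 < σ) :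
    IntegrableOn ((Ici m).indicator (fun x : ℝ => c * x ^ (-σ - 1))) (Ici 1) ∧
    ∫ x in Ici (1:ℝ), (Ici m).indicator (fun x : ℝ => c * x ^ (-σ - 1)) x = c * m ^ (-σ) / σ := by
  have hm0 : 0 < m := by linarith
  have h1 : IntegrableOn (fun x : ℝ => c * x ^ (-σ - 1)) (Ici m) := by
    rw [integrableOn_Ici_iff_integrableOn_Ioi]
    exact (integrableOn_Ioi_rpow_of_lt (by linarith) hm0).const_mul c
  constructor
  · exact ((integrable_indicator_iff measurableSet_Ici).mpr h1).integrableOn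
  · rw [setIntegral_indicator measurableSet_Ici, inter_eq_right.mpr (Ici_subset_Ici.mpr hm),
      integral_Ici_eq_integral_Ioi, integral_const_mul, integral_Ioi_rpow_of_lt (by linarith) hm0]
    have : -σ - 1 + 1 = -σ := by ring
    rw [this]
    field_simp

lemma dir_summable (hn : ∀ i, 1 ≤ n i)
    (hB : ∀ (F : Finset ι) (x : ℝ), 1 ≤ x → ∑ i ∈ F, (Ici (n i)).indicator (fun _ => |a i|) x ≤ C * x)
    {σ : ℝ} (hσ : 1 < σ) : Summable fun i => |a i| * n i ^ (-σ) := by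
  have hσ0 : 0 < σ := by linarith
  refine summable_of_sum_le (c := σ * ∫ x in Ici (1:ℝ), C * x ^ (-σ)) ?_ ?_
  · intro i
    have := hn i
    have : 0 ≤ n i ^ (-σ) := Real.rpow_nonneg (by linarith) _
    positivity
  · intro F
    have h1 : ∀ i, |a i| * n i ^ (-σ) = σ * ∫ x in Ici (1:ℝ), (Ici (n i)).indicator (fun x : ℝ => |a i| * x ^ (-σ - 1)) x := by
      intro i
      rw [(int_ind_real (n i) (|a i|) σ (hn i) hσ).2]; field_simp
    rw [Finset.sum_congr rfl (fun i _ => h1 i), ← Finset.mul_sum]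
    gcongr
    rw [← integral_finsetSum]
    · apply setIntegral_mono_on
      · exact integrable_finsetSum _ (fun i _ => (int_ind_real (n i) (|a i|) σ (hn i) hσ).1)
      · change IntegrableOn (fun x : ℝ => C * x ^ (-σ)) (Ici 1)
        rw [integrableOn_Ici_iff_integrableOn_Ioi]
        exact (integrableOn_Ioi_rpow_of_lt (by linarith) one_pos).const_mul C
      · exact measurableSet_Ici
      · intro x hx
        have hx1 : (1:ℝ) ≤ x := hx
        have hx0 : 0 < x := by linarith
        have h2 := hB F x hx1
        have h3 : ∀ i, (Ici (n i)).indicator (fun x : ℝ => |a i| * x ^ (-σ - 1)) x =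
            (Ici (n i)).indicator (fun _ => |a i|) x * x ^ (-σ - 1) := by
          intro i
          by_cases h : x ∈ Ici (n i)
          · rw [indicator_of_mem h, indicator_of_mem h]
          · rw [indicator_of_notMem h, indicator_of_notMem h, zero_mul]
        rw [Finset.sum_congr rfl (fun i _ => h3 i), ← Finset.sum_mul]
        have h4 : x ^ (-σ) = x * x ^ (-σ - 1) := by
          rw [Real.rpow_sub_one hx0.ne']; field_simp
        rw [h4, ← mul_assoc]
        have : 0 ≤ x ^ (-σ - 1) := Real.rpow_nonneg hx0.le _
        gcongr
    · exact fun i _ => (int_ind_real (n i) (|a i|) σ (hn i) hσ).1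

lemma norm_term {m c : ℝ} (hm : 1 ≤ m) (s : ℂ) : ‖(c : ℂ) * (m : ℂ) ^ (-s)‖ = |c| * m ^ (-s.re) := by
  rw [norm_mul, norm_real, Real.norm_eq_abs, norm_cpow_eq_rpow_re_of_pos (by linarith), neg_re]

lemma dir_hasSum [Countable ι] (hn : ∀ i, 1 ≤ n i) (hfin : ∀ x, {i | n i ≤ x}.Finite)
    (hB : ∀ (F : Finset ι) (x : ℝ), 1 ≤ x → ∑ i ∈ F, (Ici (n i)).indicator (fun _ => |a i|) x ≤ C * x)
    {A : ℝ → ℝ} (hA : ∀ x, A x = ∑ᶠ i ∈ {i | n i ≤ x}, a i)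
    {s : ℂ} (hs : 1 < s.re) : HasSum (fun i => (a i : ℂ) * (n i : ℂ) ^ (-s)) (s * RM A s) := by
  have hs0 : s ≠ 0 := by rintro rfl; simp at hs; linarith
  set F : ι → ℝ → ℂ := fun i => (Ici (n i)).indicator (fun x : ℝ => (a i : ℂ) * (x : ℂ) ^ (-s - 1)) with hF
  have hFi : ∀ i, Integrable (F i) (volume.restrict (Ici 1)) := by
    intro i
    have h1 : IntegrableOn (fun x : ℝ => (a i : ℂ) * (x : ℂ) ^ (-s - 1)) (Ici (n i)) := by
      rw [integrableOn_Ici_iff_integrableOn_Ioi]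
      exact (integrableOn_Ioi_cpow_of_lt (by simp; linarith) (by linarith [hn i])).const_mul _
    exact ((integrable_indicator_iff measurableSet_Ici).mpr h1).integrableOn
  have hFv : ∀ i, ∫ x in Ici (1:ℝ), F i x = (a i : ℂ) * (n i : ℂ) ^ (-s) / s := by
    intro i
    rw [hF]
    simp only
    rw [setIntegral_indicator measurableSet_Ici, inter_eq_right.mpr (Ici_subset_Ici.mpr (hn i)),
      integral_Ici_eq_integral_Ioi, integral_const_mul,
      integral_Ioi_cpow_of_lt (by simp; linarith) (by linarith [hn i])]
    have : -s - 1 + 1 = -s := by ring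
    rw [this]
    field_simp
  have hFn : ∀ i, ∫ x in Ici (1:ℝ), ‖F i x‖ = |a i| * n i ^ (-s.re) / s.re := by
    intro i
    rw [← (int_ind_real (n i) (|a i|) s.re (hn i) hs).2]
    apply setIntegral_congr_fun measurableSet_Ici
    intro x hx
    have hx1 : (1:ℝ) ≤ x := hx
    simp only [hF]
    rw [norm_indicator_eq_indicator_norm]
    by_cases h : x ∈ Ici (n i)
    · rw [indicator_of_mem h, indicator_of_mem h, norm_mul, norm_real, Real.norm_eq_abs,
        norm_cpow_eq_rpow_re_of_pos (by linarith)]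
      simp
    · rw [indicator_of_notMem h, indicator_of_notMem h]
  have key := hasSum_integral_of_summable_integral_norm hFi (by
    simp only [hFn]
    exact (dir_summable hn hB hs).div_const _)
  simp only [hFv] at key
  have h2 : ∀ x, ∑' i, F i x = (x : ℂ) ^ (-s - 1) * (A x : ℂ) := by
    intro x
    rw [tsum_eq_sum (s := (hfin x).toFinset)]
    · rw [hA x, finsum_mem_eq_finite_toFinset_sum _ (hfin x), ofReal_sum, Finset.mul_sum]
      apply Finset.sum_congr rfl
      intro i hi
      have : x ∈ Ici (n i) := by simpa using hi
      simp only [hF]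
      rw [indicator_of_mem this, mul_comm]
    · intro i hi
      have : x ∉ Ici (n i) := by simpa using hi
      simp only [hF]
      rw [indicator_of_notMem this]
  simp only [h2] at key
  rw [integral_Ici_eq_integral_Ioi, ← RM_eq] at key
  have := key.mul_left s
  have e : (fun i => s * ((a i : ℂ) * (n i : ℂ) ^ (-s) / s)) = fun i => (a i : ℂ) * (n i : ℂ) ^ (-s) := by
    funext i; field_simp
  rwa [e] at this
end

section
open MeasureTheory Set

noncomputable def nE (p : ℕ → ℝ) (e : ℕ →₀ ℕ) : ℝ := ∏ i ∈ e.support, p i ^ e i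
noncomputable def iS (S : Finset ℕ) : ℕ →₀ ℕ := Finsupp.indicator S (fun _ _ => 1)

lemma iS_apply (S : Finset ℕ) (i : ℕ) : iS S i = if i ∈ S then 1 else 0 := by
  simp [iS, Finsupp.indicator_apply]

lemma iS_support (S : Finset ℕ) : (iS S).support = S := by
  ext i; simp [iS_apply]

lemma iS_inj : Function.Injective iS := by
  intro S T h
  rw [← iS_support S, ← iS_support T, h]

lemma single_inj : Function.Injective (fun ik : ℕ × ℕ => Finsupp.single ik.1 (ik.2 + 1)) := by
  rintro ⟨i, k⟩ ⟨j, l⟩ h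
  simp only [Finsupp.single_eq_single_iff] at h
  rcases h with h | h
  · simp; omega
  · omega

variable {p : ℕ → ℝ} (hp : ∀ i, 1 < p i)

lemma nE_add (e f : ℕ →₀ ℕ) : nE p (e + f) = nE p e * nE p f := by
  have := Finsupp.prod_add_index' (f := e) (g := f) (h := fun i k => p i ^ k) (by simp) (fun i k l => pow_add _ _ _)
  exact this

lemma nE_single (i k : ℕ) : nE p (Finsupp.single i k) = p i ^ k := by
  have := Finsupp.prod_single_index (a := i) (b := k) (h := fun i k => p i ^ k) (by simp)
  exact this

lemma nE_zero : nE p 0 = 1 := by simp [nE]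

lemma nE_iS (S : Finset ℕ) : nE p (iS S) = ∏ i ∈ S, p i := by
  rw [nE, iS_support]
  apply Finset.prod_congr rfl
  intro i hi
  simp [iS_apply, hi]

include hp

lemma nE_one_le (e : ℕ →₀ ℕ) : 1 ≤ nE p e := by
  unfold nE
  calc (1:ℝ) = ∏ i ∈ e.support, (1:ℝ) := by simp
    _ ≤ _ := Finset.prod_le_prod (fun _ _ => zero_le_one) (fun i _ => one_le_pow₀ (hp i).le)

lemma nE_pos (e : ℕ →₀ ℕ) : 0 < nE p e := lt_of_lt_of_le one_pos (nE_one_le hp e)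

lemma nE_ge_pow (e : ℕ →₀ ℕ) (i : ℕ) : p i ^ e i ≤ nE p e := by
  have h : e = (e - Finsupp.single i (e i)) + Finsupp.single i (e i) := by
    rw [tsub_add_cancel_of_le]; simp
  have h2 : nE p e = nE p (e - Finsupp.single i (e i)) * p i ^ e i := by
    conv_lhs => rw [h]
    rw [nE_add, nE_single]
  rw [h2]
  have h1 := nE_one_le hp (e - Finsupp.single i (e i))
  have h3 : 0 < p i ^ e i := pow_pos (by linarith [hp i]) _
  nlinarith

lemma finE (hmono : Monotone p) (htop : Tendsto p atTop atTop) (x : ℝ) : {e | nE p e ≤ x}.Finite := by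
  obtain ⟨m, hm⟩ := (htop.eventually_gt_atTop x).exists_forall_of_atTop
  obtain ⟨K, hK⟩ := pow_unbounded_of_one_lt x (hp 0)
  refine (Set.finite_Iic (Finsupp.indicator (Finset.range m) (fun _ _ => K))).subset ?_
  intro e he
  have he : nE p e ≤ x := he
  intro i
  have h1 := (nE_ge_pow hp e i).trans he
  rw [Finsupp.indicator_apply]
  split_ifs with h
  · by_contra hlt
    push Not at hlt
    have h2 : p 0 ^ K ≤ p i ^ e i := by
      calc p 0 ^ K ≤ p 0 ^ e i := pow_le_pow_right₀ (hp 0).le hlt.le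
        _ ≤ p i ^ e i := pow_le_pow_left₀ (by linarith [hp 0]) (hmono (Nat.zero_le i)) _
    linarith
  · have hi : m ≤ i := by simpa using h
    have h2 := hm i hi
    by_contra hlt
    have h3 : p i ≤ p i ^ e i := le_self_pow₀ (hp i).le (by omega)
    linarith

omit hp
variable (hfin : ∀ x, {e | nE p e ≤ x}.Finite)
include hfin

lemma finS (x : ℝ) : {S : Finset ℕ | ∏ i ∈ S, p i ≤ x}.Finite := by
  have := (hfin x).preimage (iS_inj.injOn (s := iS ⁻¹' {e | nE p e ≤ x}))
  refine this.subset ?_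
  intro S hS
  simp only [mem_preimage, mem_ofPred_eq, nE_iS]
  exact hS

lemma finK (x : ℝ) : {ik : ℕ × ℕ | p ik.1 ^ (ik.2 + 1) ≤ x}.Finite := by
  have := (hfin x).preimage (single_inj.injOn (s := (fun ik : ℕ × ℕ => Finsupp.single ik.1 (ik.2 + 1)) ⁻¹' {e | nE p e ≤ x}))
  refine this.subset ?_
  intro S hS
  simp only [mem_preimage, mem_ofPred_eq, nE_single]
  exact hS

omit hfin in
lemma psi_eq (x : ℝ) : psiP p x = ∑ᶠ ik ∈ {ik : ℕ × ℕ | p ik.1 ^ (ik.2 + 1) ≤ x}, Real.log (p ik.1) := by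
  symm
  apply finsum_mem_eq_of_bijOn (fun ik : ℕ × ℕ => (ik.1, ik.2 + 1))
  · refine ⟨?_, ?_, ?_⟩
    · rintro ⟨i, k⟩ h
      exact ⟨by simp, h⟩
    · rintro ⟨i, k⟩ _ ⟨j, l⟩ _ h
      simpa using h
    · rintro ⟨i, k⟩ ⟨h1, h2⟩
      refine ⟨(i, k - 1), ?_, ?_⟩
      · simp only [mem_ofPred_eq] at h1 h2 ⊢
        rwa [Nat.sub_add_cancel h1]
      · simp only [] at h1 ⊢
        rw [Nat.sub_add_cancel h1]
  · intro ik _; rfl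

lemma psi_sum (x : ℝ) : psiP p x = ∑ ik ∈ (finK hfin x).toFinset, Real.log (p ik.1) := by
  rw [psi_eq, finsum_mem_eq_finite_toFinset_sum _ (finK hfin x)]

lemma NP_card (x : ℝ) : NP p x = (hfin x).toFinset.card := by
  rw [NP]
  exact Nat.card_eq_card_finite_toFinset (hfin x)

lemma NP_finsum (x : ℝ) : (NP p x : ℝ) = ∑ᶠ e ∈ {e | nE p e ≤ x}, (1:ℝ) := by
  rw [NP_card hfin, finsum_mem_eq_finite_toFinset_sum _ (hfin x)]; simp

lemma MP_sum (x : ℝ) : MP p x = ∑ S ∈ (finS hfin x).toFinset, (-1 : ℝ) ^ S.card := by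
  rw [MP, finsum_mem_eq_finite_toFinset_sum _ (finS hfin x)]

lemma NP_mono : Monotone (fun x => (NP p x : ℝ)) := by
  intro x y h
  simp only [NP_card hfin]
  norm_cast
  apply Finset.card_le_card
  intro e he
  simp only [Finite.mem_toFinset, mem_ofPred_eq] at he ⊢
  linarith

lemma psi_mono (hp : ∀ i, 1 < p i) : Monotone (psiP p) := by
  intro x y h
  rw [psi_sum hfin, psi_sum hfin]
  apply Finset.sum_le_sum_of_subset_of_nonneg
  · intro e he
    simp only [Finite.mem_toFinset, mem_ofPred_eq] at he ⊢
    linarith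
  · intro i _ _
    exact Real.log_nonneg (hp _).le

lemma M_diff {x y : ℝ} (h : x ≤ y) : |MP p y - MP p x| ≤ (NP p y : ℝ) - NP p x := by
  rw [MP_sum hfin, MP_sum hfin, NP_card hfin, NP_card hfin]
  have h1 : (finS hfin x).toFinset ⊆ (finS hfin y).toFinset := by
    intro e he
    simp only [Finite.mem_toFinset, mem_ofPred_eq] at he ⊢
    linarith
  have h2 : (hfin x).toFinset ⊆ (hfin y).toFinset := by
    intro e he
    simp only [Finite.mem_toFinset, mem_ofPred_eq] at he ⊢
    linarith
  rw [← Finset.sum_sdiff h1, add_sub_cancel_right, ← Nat.cast_sub (Finset.card_le_card h2),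
    ← Finset.card_sdiff_of_subset h2]
  refine (Finset.abs_sum_le_sum_abs _ _).trans ?_
  simp only [abs_pow, abs_neg, abs_one, one_pow, Finset.sum_const, nsmul_eq_mul, mul_one]
  norm_cast
  apply Finset.card_le_card_of_injOn iS _ iS_inj.injOn
  intro S hS
  simpa [nE_iS] using hS

lemma M_le (hp : ∀ i, 1 < p i) (x : ℝ) : |MP p x| ≤ NP p x := by
  have hN : ∀ y < 1, NP p y = 0 := by
    intro y hy
    rw [NP_card hfin, Finset.card_eq_zero, Finset.eq_empty_iff_forall_notMem]
    intro e he
    simp only [Finite.mem_toFinset, mem_ofPred_eq] at he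
    linarith [nE_one_le hp e]
  have hM : ∀ y < 1, MP p y = 0 := by
    intro y hy
    rw [MP_sum hfin]
    have : (finS hfin y).toFinset = ∅ := by
      rw [Finset.eq_empty_iff_forall_notMem]
      intro e he
      simp only [Finite.mem_toFinset, mem_ofPred_eq] at he
      rw [← nE_iS] at he
      linarith [nE_one_le hp (iS e)]
    rw [this]; simp
  by_cases hx : x < 1
  · rw [hN x hx, hM x hx]; simp
  · have := M_diff hfin (x := 0) (y := x) (by linarith)
    rw [hN 0 one_pos, hM 0 one_pos] at this
    simpa using this

lemma N_meas : Measurable (fun x => (NP p x : ℝ)) := (NP_mono hfin).measurable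

lemma M_meas : Measurable (MP p) := by
  have : Monotone (fun x => MP p x + (NP p x : ℝ)) := by
    intro x y h
    have := abs_le.mp (M_diff hfin h)
    simp only
    linarith [this.1]
  have h2 := this.measurable.sub (N_meas hfin)
  have e : MP p = fun x => MP p x + (NP p x : ℝ) - (NP p x : ℝ) := by
    funext x; ring
  rw [e]; exact h2

lemma hB_E {C : ℝ} (hC : ∀ x, 1 ≤ x → (NP p x : ℝ) ≤ C * x) (F : Finset (ℕ →₀ ℕ)) (x : ℝ) (hx : 1 ≤ x) :
    ∑ e ∈ F, (Ici (nE p e)).indicator (fun _ => |(1:ℝ)|) x ≤ C * x := by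
  refine le_trans ?_ (hC x hx)
  simp only [indicator_apply, mem_Ici]
  rw [← Finset.sum_filter, NP_card hfin]
  simp only [abs_one, Finset.sum_const, nsmul_eq_mul, mul_one]
  norm_cast
  apply Finset.card_le_card
  intro e he
  simp only [Finset.mem_filter] at he
  simpa using he.2

lemma hB_S {C : ℝ} (hC : ∀ x, 1 ≤ x → (NP p x : ℝ) ≤ C * x) (F : Finset (Finset ℕ)) (x : ℝ) (hx : 1 ≤ x) :
    ∑ S ∈ F, (Ici (nE p (iS S))).indicator (fun _ => |(-1:ℝ) ^ S.card|) x ≤ C * x := by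
  refine le_trans ?_ (hC x hx)
  simp only [indicator_apply, mem_Ici]
  rw [← Finset.sum_filter, NP_card hfin]
  simp only [abs_pow, abs_neg, abs_one, one_pow, Finset.sum_const, nsmul_eq_mul, mul_one]
  norm_cast
  apply Finset.card_le_card_of_injOn iS _ iS_inj.injOn
  intro e he
  simp at he
  simpa using he.2

lemma hB_K (hp : ∀ i, 1 < p i) {C : ℝ} (hC : ∀ x, 1 ≤ x → psiP p x ≤ C * x) (F : Finset (ℕ × ℕ)) (x : ℝ) (hx : 1 ≤ x) :
    ∑ ik ∈ F, (Ici (p ik.1 ^ (ik.2 + 1))).indicator (fun _ => |Real.log (p ik.1)|) x ≤ C * x := by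
  refine le_trans ?_ (hC x hx)
  simp only [indicator_apply, mem_Ici]
  rw [← Finset.sum_filter, psi_sum hfin]
  have h0 : ∀ i, 0 ≤ Real.log (p i) := fun i => Real.log_nonneg (hp _).le
  simp only [abs_of_nonneg (h0 _)]
  apply Finset.sum_le_sum_of_subset_of_nonneg
  · intro e he
    simp only [Finset.mem_filter] at he
    simpa using he.2
  · intro i _ _
    exact h0 _

end

section
open MeasureTheory Set Complex

variable {p : ℕ → ℝ} (hp : ∀ i, 1 < p i)

noncomputable def tE (p : ℕ → ℝ) (s : ℂ) (e : ℕ →₀ ℕ) : ℂ := (nE p e : ℂ) ^ (-s)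

include hp in
lemma tE_add (s : ℂ) (e f : ℕ →₀ ℕ) : tE p s (e + f) = tE p s e * tE p s f := by
  unfold tE
  rw [nE_add, ofReal_mul, mul_cpow_ofReal_nonneg (nE_pos hp e).le (nE_pos hp f).le]

include hp in
lemma conv_tE {J : Type*} (w : J → (ℕ →₀ ℕ)) (c : J → ℂ) (s : ℂ)
    (hE : Summable fun e => ‖tE p s e‖) (hJ : Summable fun j => ‖c j * tE p s (w j)‖) :
    HasSum (fun f => ∑' j, if w j ≤ f then c j * tE p s f else 0)
      ((∑' e, tE p s e) * ∑' j, c j * tE p s (w j)) := by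
  have h1 : HasSum (fun x : (ℕ →₀ ℕ) × J => tE p s x.1 * (c x.2 * tE p s (w x.2)))
      ((∑' e, tE p s e) * ∑' j, c j * tE p s (w j)) := by
    rw [tsum_mul_tsum_of_summable_norm hE hJ]
    exact (summable_mul_of_summable_norm hE hJ).hasSum
  set φ : (ℕ →₀ ℕ) × J → (ℕ →₀ ℕ) × J := fun x => (x.1 + w x.2, x.2) with hφ
  have hinj : Function.Injective φ := by
    rintro ⟨e, j⟩ ⟨f, k⟩ h
    simp only [hφ, Prod.mk.injEq] at h
    obtain ⟨h1, rfl⟩ := h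
    simpa using h1
  set g : (ℕ →₀ ℕ) × J → ℂ := fun x => if w x.2 ≤ x.1 then c x.2 * tE p s x.1 else 0 with hg
  have h2 : g ∘ φ = fun x : (ℕ →₀ ℕ) × J => tE p s x.1 * (c x.2 * tE p s (w x.2)) := by
    funext x
    simp only [hg, hφ, Function.comp]
    rw [if_pos (by simp), tE_add hp]; ring
  rw [← h2, hinj.hasSum_iff] at h1
  · exact h1.prod_fiberwise (fun f => (h1.summable.prod_factor f).hasSum)
  · rintro ⟨f, j⟩ hx
    simp only [hg]
    rw [if_neg]
    intro hle
    exact hx ⟨(f - w j, j), by simp [hφ, tsub_add_cancel_of_le hle]⟩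

include hp in
lemma I1 (s : ℂ)
    (hE : Summable fun e => ‖tE p s e‖)
    (hJ : Summable fun S : Finset ℕ => ‖(-1 : ℂ) ^ S.card * tE p s (iS S)‖) :
    (∑' e, tE p s e) * ∑' S : Finset ℕ, (-1 : ℂ) ^ S.card * tE p s (iS S) = 1 := by
  have h := conv_tE hp iS (fun S => (-1 : ℂ) ^ S.card) s hE hJ
  have hle : ∀ (S : Finset ℕ) (f : ℕ →₀ ℕ), iS S ≤ f ↔ S ⊆ f.support := by
    intro S f
    constructor
    · intro h i hi
      have := h i
      rw [iS_apply, if_pos hi] at this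
      simp; omega
    · intro h i
      rw [iS_apply]
      split_ifs with hi
      · have := h hi
        simp at this; omega
      · exact Nat.zero_le _
  have h2 : ∀ f : ℕ →₀ ℕ, (∑' S, if iS S ≤ f then (-1 : ℂ) ^ S.card * tE p s f else 0) = if f = 0 then 1 else 0 := by
    intro f
    rw [tsum_eq_sum (s := f.support.powerset)]
    · rw [Finset.sum_congr rfl (g := fun S => (-1 : ℂ) ^ S.card * tE p s f)]
      · rw [← Finset.sum_mul]
        have := Finset.sum_powerset_neg_one_pow_card (x := f.support)
        have h3 : ∑ S ∈ f.support.powerset, (-1 : ℂ) ^ S.card = if f.support = ∅ then 1 else 0 := by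
          have := congrArg (fun z : ℤ => (z : ℂ)) this
          push_cast at this
          exact this
        rw [h3]
        by_cases hf : f = 0
        · simp [hf, tE, nE_zero]
        · simp [hf]
      · intro S hS
        rw [if_pos]
        rw [hle]; simpa using hS
    · intro S hS
      rw [if_neg]
      rw [hle]; simpa using hS
  simp only [h2] at h
  rw [← h.tsum_eq]
  simp

include hp in
lemma log_nE (f : ℕ →₀ ℕ) : Real.log (nE p f) = ∑ i ∈ f.support, f i * Real.log (p i) := by
  unfold nE
  rw [Real.log_prod]
  · apply Finset.sum_congr rfl
    intro i _
    rw [Real.log_pow]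
  · intro i _
    exact pow_ne_zero _ (by linarith [hp i])

include hp in
lemma I2 (s : ℂ)
    (hE : Summable fun e => ‖tE p s e‖)
    (hJ : Summable fun ik : ℕ × ℕ => ‖(Real.log (p ik.1) : ℂ) * tE p s (Finsupp.single ik.1 (ik.2 + 1))‖) :
    HasSum (fun f => (Real.log (nE p f) : ℂ) * tE p s f)
    ((∑' e, tE p s e) * ∑' ik : ℕ × ℕ, (Real.log (p ik.1) : ℂ) * tE p s (Finsupp.single ik.1 (ik.2 + 1))) := by
  have h := conv_tE hp (fun ik : ℕ × ℕ => Finsupp.single ik.1 (ik.2 + 1)) (fun ik => (Real.log (p ik.1) : ℂ)) s hE hJ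
  have h2 : ∀ f : ℕ →₀ ℕ, (∑' ik : ℕ × ℕ, if Finsupp.single ik.1 (ik.2 + 1) ≤ f then (Real.log (p ik.1) : ℂ) * tE p s f else 0)
      = (Real.log (nE p f) : ℂ) * tE p s f := by
    intro f
    simp only [Finsupp.single_le_iff]
    rw [tsum_eq_sum (s := f.support ×ˢ Finset.range (f.support.sup f))]
    · rw [Finset.sum_product, log_nE hp, ofReal_sum, Finset.sum_mul]
      apply Finset.sum_congr rfl
      intro i hi
      simp only []
      rw [← Finset.sum_filter]
      have : (Finset.range (f.support.sup f)).filter (fun k => k + 1 ≤ f i) = Finset.range (f i) := by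
        ext k
        have h1 : f i ≤ f.support.sup f := Finset.le_sup hi
        simp only [Finset.mem_filter, Finset.mem_range]
        omega
      rw [this]
      simp
      ring
    · rintro ⟨i, k⟩ hik
      rw [if_neg]
      intro hle
      apply hik
      simp only [] at hle
      have hi : i ∈ f.support := by simp; omega
      have h1 : f i ≤ f.support.sup f := Finset.le_sup hi
      simp only [Finset.mem_product, Finset.mem_range]
      exact ⟨hi, by omega⟩
  simp only [h2] at h
  exact h

include hp in
lemma Z_deriv (hsum : ∀ σ : ℝ, 1 < σ → Summable fun e => nE p e ^ (-σ)) {s : ℂ} (hs : 1 < s.re) :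
    HasSum (fun f => -((Real.log (nE p f) : ℂ) * tE p s f)) (deriv (fun s => ∑' e, tE p s e) s) := by
  set σ := (1 + s.re) / 2 with hσ
  have h1 : 1 < σ := by simp only [hσ]; linarith
  have h := hasSum_deriv_of_summable_norm (F := fun e s => tE p s e) (U := {w : ℂ | σ < w.re}) (z := s)
    (hsum σ h1) ?_ (isOpen_hp σ) ?_ (show σ < s.re by simp only [hσ]; linarith)
  · have e : ∀ f, deriv (fun s => tE p s f) s = -((Real.log (nE p f) : ℂ) * tE p s f) := by
      intro f
      have hne : (nE p f : ℂ) ≠ 0 := by exact_mod_cast (nE_pos hp f).ne'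
      have := ((hasDerivAt_id s).neg.const_cpow (c := (nE p f : ℂ)) (Or.inl hne)).deriv
      have h3 : deriv (fun s => tE p s f) s = (nE p f : ℂ) ^ (-s) * log (nE p f : ℂ) * (-1) := this
      rw [h3, ofReal_log (nE_pos hp f).le]
      unfold tE; ring
    simp only [e] at h
    exact h
  · intro e w hw
    have hne : (nE p e : ℂ) ≠ 0 := by exact_mod_cast (nE_pos hp e).ne'
    exact (differentiableAt_id.neg.const_cpow (Or.inl hne)).differentiableWithinAt
  · intro e w hw
    have hw : σ < w.re := hw
    unfold tE
    rw [norm_cpow_eq_rpow_re_of_pos (nE_pos hp e), neg_re]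
    exact Real.rpow_le_rpow_of_exponent_le (nE_one_le hp e) (by linarith)

include hp in
lemma tE_norm (s : ℂ) (e : ℕ →₀ ℕ) : ‖tE p s e‖ = nE p e ^ (-s.re) := by
  unfold tE
  rw [norm_cpow_eq_rpow_re_of_pos (nE_pos hp e), neg_re]

/-- Z near 1 for large real part. -/
lemma Z_near {q : ℝ} (hp : ∀ i, 1 < p i) (hq : 1 < q) (hpq : ∀ i, q ≤ p i) (hsum : ∀ σ : ℝ, 1 < σ → Summable fun e => nE p e ^ (-σ))
    {η : ℝ} (hη : 0 < η) :
    ∃ b : ℝ, 2 ≤ b ∧ ∀ s : ℂ, b < s.re → ‖(∑' e, tE p s e) - 1‖ ≤ η := by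
  set T := ∑' e, nE p e ^ (-(2:ℝ)) with hT
  have hT0 : 0 ≤ T := tsum_nonneg (fun e => Real.rpow_nonneg (nE_pos hp e).le _)
  obtain ⟨k, hk⟩ := pow_unbounded_of_one_lt (T / η) hq
  refine ⟨2 + k, by simp, fun s hs => ?_⟩
  have hk0 : (0:ℝ) ≤ k := Nat.cast_nonneg k
  have hsE : Summable (fun e => tE p s e) := by
    apply Summable.of_norm
    simp only [tE_norm hp]
    exact hsum _ (by linarith)
  have hq0 : 0 < q ^ k := by positivity
  have h2 := hsum 2 (by norm_num)
  have h1 : ∑' e, tE p s e = 1 + ∑' e, (if e = 0 then 0 else tE p s e) := by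
    rw [hsE.tsum_eq_add_tsum_ite 0]
    congr 1
    simp [tE, nE_zero]
  rw [h1, add_sub_cancel_left]
  have hb : ∀ e, ‖(if e = 0 then 0 else tE p s e : ℂ)‖ ≤ (q ^ k)⁻¹ * nE p e ^ (-(2:ℝ)) := by
    intro e
    have hnn : 0 ≤ nE p e ^ (-(2:ℝ)) := Real.rpow_nonneg (nE_pos hp e).le _
    split_ifs with he
    · simp; positivity
    · rw [tE_norm hp]
      obtain ⟨i, hi⟩ := Finsupp.ne_iff.mp he
      have hi : e i ≠ 0 := by simpa using hi
      have hqe : q ≤ nE p e := (hpq i).trans ((le_self_pow₀ (hp i).le hi).trans (nE_ge_pow hp e i))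
      have h3 : nE p e ^ (-s.re) ≤ nE p e ^ (-(k:ℝ) + (-(2:ℝ))) :=
        Real.rpow_le_rpow_of_exponent_le (nE_one_le hp e) (by linarith)
      rw [Real.rpow_add (nE_pos hp e), Real.rpow_neg (nE_pos hp e).le (k:ℝ), Real.rpow_natCast] at h3
      refine h3.trans ?_
      gcongr
  have h4 := tsum_of_norm_bounded ((h2.mul_left (q ^ k)⁻¹).hasSum) hb
  refine h4.trans ?_
  rw [tsum_mul_left, ← hT, inv_mul_le_iff₀ hq0]
  rw [div_lt_iff₀ hη] at hk
  exact hk.le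

end

section
open MeasureTheory Set Complex

lemma ident_hp {σ : ℝ} {f g : ℂ → ℂ} (hf : ∀ s : ℂ, σ < s.re → DifferentiableAt ℂ f s)
    (hg : ∀ s : ℂ, σ < s.re → DifferentiableAt ℂ g s) (h : ∀ s : ℂ, 1 < s.re → f s = g s) :
    ∀ s : ℂ, σ < s.re → f s = g s := by
  have hfa : AnalyticOnNhd ℂ f {s | σ < s.re} :=
    DifferentiableOn.analyticOnNhd (fun z hz => (hf z hz).differentiableWithinAt) (isOpen_hp σ)
  have hga : AnalyticOnNhd ℂ g {s | σ < s.re} :=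
    DifferentiableOn.analyticOnNhd (fun z hz => (hg z hz).differentiableWithinAt) (isOpen_hp σ)
  have h0 : ((max σ 1 + 1 : ℝ) : ℂ) ∈ {s : ℂ | σ < s.re} := by
    simp only [mem_ofPred_eq, ofReal_re]; linarith [le_max_left σ 1]
  have h1 : (1:ℝ) < ((max σ 1 + 1 : ℝ) : ℂ).re := by
    simp only [ofReal_re]; linarith [le_max_right σ 1]
  have := hfa.eqOn_of_preconnected_of_eventuallyEq hga (convex_hp σ).isPreconnected h0
    (Filter.eventually_of_mem ((isOpen_hp 1).mem_nhds h1) (fun z hz => h z hz))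
  intro s hs
  exact this hs

noncomputable def GG (p : ℕ → ℝ) (ρ : ℝ) (s : ℂ) : ℂ :=
  ρ + (s - 1) * RM (fun x => (NP p x : ℝ) - ρ * x) s

variable {p : ℕ → ℝ} {ρ : ℝ}

section one
variable (hp : ∀ i, 1 < p i) (hfin : ∀ x, {e | nE p e ≤ x}.Finite)
    {C : ℝ} (hN : ∀ x, 1 ≤ x → (NP p x : ℝ) ≤ C * x)
include hp hfin hN

lemma sumE {σ : ℝ} (hσ : 1 < σ) : Summable fun e => nE p e ^ (-σ) := by
  have := dir_summable (nE_one_le hp) (hB_E hfin hN) hσ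
  simpa using this

lemma sumE_norm {s : ℂ} (hs : 1 < s.re) : Summable fun e => ‖tE p s e‖ := by
  simp only [tE_norm hp]
  exact sumE hp hfin hN hs

lemma Z_eq {s : ℂ} (hs : 1 < s.re) : ∑' e, tE p s e = s * RM (fun x => (NP p x : ℝ)) s := by
  have := dir_hasSum (nE_one_le hp) hfin (hB_E hfin hN) (NP_finsum hfin) hs
  have h2 := this.tsum_eq
  simpa [tE] using h2

lemma mu_eq {s : ℂ} (hs : 1 < s.re) : (∑' e, tE p s e) * (s * RM (MP p) s) = 1 := by
  have hA : ∀ x, MP p x = ∑ᶠ S ∈ {S : Finset ℕ | nE p (iS S) ≤ x}, (-1 : ℝ) ^ S.card := by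
    intro x
    simp only [nE_iS]
    rfl
  have hf : ∀ x, {S : Finset ℕ | nE p (iS S) ≤ x}.Finite := by
    intro x
    simp only [nE_iS]
    exact finS hfin x
  have h1 := dir_hasSum (fun S => nE_one_le hp (iS S)) hf (hB_S hfin hN) hA hs
  have h2 := dir_summable (fun S => nE_one_le hp (iS S)) (hB_S hfin hN) hs
  have h3 := I1 hp s (sumE_norm hp hfin hN hs) (by
    simpa [tE_norm hp] using h2)
  rw [← h1.tsum_eq]
  simpa [tE] using h3

lemma G_eq {s : ℂ} (hs : 1 < s.re) : GG p ρ s = (s - 1) * (∑' e, tE p s e) / s := by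
  have hs0 : s ≠ 0 := by rintro rfl; simp at hs; linarith
  have hs1 : s - 1 ≠ 0 := by
    intro h
    have := congrArg re h
    simp at this; linarith
  rw [Z_eq hp hfin hN hs, GG, RM_sub (C := C) (C' := |ρ|) (θ := 1) (N_meas hfin) ?_ (by fun_prop) ?_ hs, RM_lin ρ hs]
  · field_simp; ring
  · intro x hx
    rw [Real.rpow_one, abs_of_nonneg (Nat.cast_nonneg _)]
    exact hN x hx
  · intro x hx
    rw [Real.rpow_one, abs_mul, abs_of_nonneg (by linarith : 0 ≤ x)]

lemma G_ne {s : ℂ} (hs : 1 < s.re) : GG p ρ s ≠ 0 := by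
  have hs0 : s ≠ 0 := by rintro rfl; simp at hs; linarith
  have hs1 : s - 1 ≠ 0 := by
    intro h
    have := congrArg re h
    simp at this; linarith
  have h1 := mu_eq hp hfin hN hs
  rw [G_eq hp hfin hN hs]
  have : ∑' e, tE p s e ≠ 0 := left_ne_zero_of_mul (h1 ▸ one_ne_zero)
  positivity

lemma E_M {s : ℂ} (hs : 1 < s.re) : (s - 1) / (s ^ 2 * GG p ρ s) = RM (MP p) s := by
  have hs0 : s ≠ 0 := by rintro rfl; simp at hs; linarith
  have hs1 : s - 1 ≠ 0 := by
    intro h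
    have := congrArg re h
    simp at this; linarith
  have h1 := mu_eq hp hfin hN hs
  rw [G_eq hp hfin hN hs]
  have hZ : ∑' e, tE p s e ≠ 0 := left_ne_zero_of_mul (h1 ▸ one_ne_zero)
  field_simp
  linear_combination -h1

lemma G_near (hmono : Monotone p) : ∃ b, ∀ s : ℂ, b < s.re → ‖GG p ρ s - 1‖ ≤ 1 / 2 := by
  obtain ⟨b, hb2, hb⟩ := Z_near hp (hp 0) (fun i => hmono (Nat.zero_le i))
    (fun σ hσ => sumE hp hfin hN hσ) (η := 1 / 8) (by norm_num)
  refine ⟨max b 8, fun s hs => ?_⟩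
  have h1 := hb s (lt_of_le_of_lt (le_max_left _ _) hs)
  have h8 : 8 < s.re := lt_of_le_of_lt (le_max_right _ _) hs
  have hs0 : s ≠ 0 := by rintro rfl; simp at h8; linarith
  rw [G_eq hp hfin hN (by linarith)]
  set Z := ∑' e, tE p s e
  have hn : 8 ≤ ‖s‖ := h8.le.trans ((le_abs_self _).trans (abs_re_le_norm s))
  have e : (s - 1) * Z / s - 1 = (Z - 1) - (Z - 1) * s⁻¹ - s⁻¹ := by field_simp; ring
  rw [e]
  have h2 : ‖s⁻¹‖ ≤ 1 / 8 := by
    rw [norm_inv, one_div]; gcongr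
  have h3 : ‖(Z - 1) * s⁻¹‖ ≤ 1 / 8 * (1 / 8) := by
    rw [norm_mul]; gcongr
  have h4 := norm_sub_le ((Z - 1) - (Z - 1) * s⁻¹) s⁻¹
  have h5 := norm_sub_le (Z - 1) ((Z - 1) * s⁻¹)
  linarith

lemma E_psi {C' : ℝ} (hψ : ∀ x, 1 ≤ x → psiP p x ≤ C' * x) {s : ℂ} (hs : 1 < s.re) :
    -(deriv (GG p ρ) s / GG p ρ s + 1 + 1 / s) / s = RM (fun x => psiP p x - x) s := by
  have hs0 : s ≠ 0 := by rintro rfl; simp at hs; linarith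
  have hs1 : s - 1 ≠ 0 := by
    intro h
    have := congrArg re h
    simp at this; linarith
  have hK := dir_hasSum (n := fun ik : ℕ × ℕ => p ik.1 ^ (ik.2 + 1)) (fun ik => one_le_pow₀ (hp ik.1).le)
    (finK hfin) (hB_K hfin hp hψ) psi_eq hs
  have hK2 := dir_summable (n := fun ik : ℕ × ℕ => p ik.1 ^ (ik.2 + 1)) (fun ik => one_le_pow₀ (hp ik.1).le)
    (hB_K hfin hp hψ) hs
  have h2 := I2 hp s (sumE_norm hp hfin hN hs) (by
    refine hK2.congr (fun ik => ?_)
    rw [norm_mul, tE_norm hp, nE_single, norm_real, Real.norm_eq_abs])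
  have h3 : ∑' ik : ℕ × ℕ, (Real.log (p ik.1) : ℂ) * tE p s (Finsupp.single ik.1 (ik.2 + 1)) = s * RM (psiP p) s := by
    rw [← hK.tsum_eq]
    simp only [tE, nE_single]
  rw [h3] at h2
  have h4 := Z_deriv hp (fun σ hσ => sumE hp hfin hN hσ) hs
  have hZ' := h4.unique h2.neg
  have hZne : ∑' e, tE p s e ≠ 0 := left_ne_zero_of_mul ((mu_eq hp hfin hN hs) ▸ one_ne_zero)
  -- differentiability of Z
  have hZd : DifferentiableAt ℂ (fun s => ∑' e, tE p s e) s := by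
    have hRd : DifferentiableAt ℂ (fun s => s * RM (fun x => (NP p x : ℝ)) s) s := by
      refine differentiableAt_id.mul (RM_diff (C := C) (θ := 1) (N_meas hfin) ?_ hs)
      intro x hx
      rw [Real.rpow_one, abs_of_nonneg (Nat.cast_nonneg _)]
      exact hN x hx
    refine hRd.congr_of_eventuallyEq ?_
    filter_upwards [(isOpen_hp 1).mem_nhds hs] with z hz
    exact Z_eq hp hfin hN hz
  have hGd : deriv (GG p ρ) s = (∑' e, tE p s e) / s ^ 2 + (s - 1) / s * deriv (fun s => ∑' e, tE p s e) s := by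
    have h5 : GG p ρ =ᶠ[nhds s] fun s => (s - 1) * (∑' e, tE p s e) / s := by
      filter_upwards [(isOpen_hp 1).mem_nhds hs] with z hz
      exact G_eq hp hfin hN hz
    rw [h5.deriv_eq]
    have h6 := ((((hasDerivAt_id s).sub_const 1).mul hZd.hasDerivAt).div (hasDerivAt_id s) hs0).deriv
    refine Eq.trans h6 ?_
    simp only [id, Pi.mul_apply]
    field_simp
    ring
  have hψ0 : ∀ x, 1 ≤ x → |psiP p x| ≤ C' * x := by
    intro x hx
    rw [abs_of_nonneg]
    · exact hψ x hx
    · rw [psi_sum hfin]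
      exact Finset.sum_nonneg (fun ik _ => Real.log_nonneg (hp _).le)
  have hsub : RM (fun x => psiP p x - x) s = RM (psiP p) s - 1 / (s - 1) := by
    have h7 := RM_sub (A := psiP p) (B := fun x => 1 * x) (C := C') (C' := 1) (θ := 1) (psi_mono hfin hp).measurable
      (by simpa using hψ0) (by fun_prop) (by
        intro x hx
        rw [Real.rpow_one, one_mul, abs_of_nonneg (by linarith)]) hs
    rw [RM_lin 1 hs] at h7
    simpa using h7
  rw [hsub, hGd, hZ', G_eq hp hfin hN hs]
  field_simp
  ring

end one

end

section
open MeasureTheory Set Complex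

lemma bound_all {f : ℝ → ℝ} {θ : ℝ} (hloc : ∀ X, ∃ B, ∀ x, 1 ≤ x → x ≤ X → |f x| ≤ B)
    (hf : f =O[atTop] fun x => x ^ θ) : ∃ C, 0 ≤ C ∧ ∀ x, 1 ≤ x → |f x| ≤ C * x ^ θ := by
  obtain ⟨c, hc0, hc⟩ := hf.exists_pos
  obtain ⟨X', hX'⟩ := eventually_atTop.mp hc.bound
  set X := max X' 1 with hX
  have hX1 : 1 ≤ X := le_max_right _ _
  obtain ⟨B, hB⟩ := hloc X
  set m := min 1 (X ^ θ) with hm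
  have hm0 : 0 < m := lt_min one_pos (Real.rpow_pos_of_pos (by linarith) _)
  refine ⟨c + |B| / m, by positivity, fun x hx => ?_⟩
  have hx0 : 0 < x := by linarith
  have hxθ : 0 < x ^ θ := Real.rpow_pos_of_pos hx0 _
  by_cases h : x ≤ X
  · have h1 := hB x hx h
    have h2 : m ≤ x ^ θ := by
      rcases le_total 0 θ with h0 | h0
      · exact (min_le_left _ _).trans (Real.one_le_rpow hx h0)
      · exact (min_le_right _ _).trans (Real.rpow_le_rpow_of_nonpos hx0 h h0)
    have h3 : |B| ≤ |B| / m * x ^ θ := by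
      rw [div_mul_eq_mul_div, le_div_iff₀ hm0]; gcongr
    have h4 := le_abs_self B
    have h5 : 0 < c * x ^ θ := by positivity
    rw [add_mul]
    linarith
  · have h1 := hX' x (by linarith [le_max_left X' 1])
    rw [Real.norm_eq_abs, Real.norm_eq_abs, abs_of_pos hxθ] at h1
    have h5 : 0 ≤ |B| / m * x ^ θ := by positivity
    rw [add_mul]
    linarith

lemma mono_loc {g : ℝ → ℝ} (hg : Monotone g) (c : ℝ) (X : ℝ) :
    ∃ B, ∀ x, 1 ≤ x → x ≤ X → |g x - c * x| ≤ B := by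
  refine ⟨|g 1| + |g X| + |c| * X, fun x h1 h2 => ?_⟩
  have h3 : |c * x| ≤ |c| * X := by
    rw [abs_mul, abs_of_nonneg (by linarith : 0 ≤ x)]; gcongr
  have h4 : |g x| ≤ |g 1| + |g X| := by
    rw [abs_le]
    have := hg h1
    have := hg h2
    have := neg_abs_le (g 1)
    have := le_abs_self (g X)
    constructor <;> linarith [abs_nonneg (g 1), abs_nonneg (g X)]
  exact (abs_sub _ _).trans (by linarith)

variable {p : ℕ → ℝ} {ρ : ℝ}

lemma two_rpow {x y σ : ℝ} (hx : 1 ≤ x) (hxy : x ≤ y) (hy : y ≤ 2 * x) (h0 : 0 ≤ σ) (h1 : σ ≤ 1) :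
    y ^ σ ≤ 2 * x ^ σ := by
  calc y ^ σ ≤ (2 * x) ^ σ := Real.rpow_le_rpow (by linarith) hy h0
    _ = 2 ^ σ * x ^ σ := Real.mul_rpow (by norm_num) (by linarith)
    _ ≤ 2 ^ (1:ℝ) * x ^ σ := by
      have : 0 ≤ x ^ σ := Real.rpow_nonneg (by linarith) _
      gcongr
      norm_num
    _ = _ := by rw [Real.rpow_one]

section two
variable (hmono : Monotone p) (hp : ∀ i, 1 < p i) (hfin : ∀ x, {e | nE p e ≤ x}.Finite) (hρ : 0 < ρ)
    {σ₀ : ℝ} (h0 : 0 ≤ σ₀) (h1 : σ₀ < 1)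
    (hN : ∀ θ, σ₀ < θ → ∃ C, 0 ≤ C ∧ ∀ x, 1 ≤ x → |(NP p x : ℝ) - ρ * x| ≤ C * x ^ θ)
include hmono hp hfin hρ h0 h1 hN

omit hmono hp hfin h0 in
lemma N_lin : ∃ C, 0 ≤ C ∧ ∀ x, 1 ≤ x → (NP p x : ℝ) ≤ C * x := by
  obtain ⟨C, hC0, hC⟩ := hN 1 h1
  refine ⟨ρ + C, by linarith, fun x hx => ?_⟩
  have := (abs_le.mp (hC x hx)).2
  rw [Real.rpow_one] at this
  linarith

omit hmono hp hρ h0 h1 in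
lemma GG_diff (s : ℂ) (hs : σ₀ < s.re) : DifferentiableAt ℂ (GG p ρ) s := by
  obtain ⟨C, _, hC⟩ := hN ((σ₀ + s.re) / 2) (by linarith)
  have h2 : DifferentiableAt ℂ (RM (fun x => (NP p x : ℝ) - ρ * x)) s :=
    RM_diff ((N_meas hfin).sub (by fun_prop)) hC (by linarith)
  exact (((differentiableAt_id.sub_const 1).mul h2).const_add (ρ : ℂ))

lemma goodG (hne : ∀ s : ℂ, σ₀ < s.re → GG p ρ s ≠ 0) : GoodG (GG p ρ) σ₀ := by
  refine ⟨h0, GG_diff hfin hN, hne, ?_, ?_⟩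
  · intro σ₁ hσ₁
    obtain ⟨C, hC0, hC⟩ := hN ((σ₀ + σ₁) / 2) (by linarith)
    refine ⟨ρ + C / (σ₁ - (σ₀ + σ₁) / 2), fun s hs => ?_⟩
    have hd : 0 < σ₁ - (σ₀ + σ₁) / 2 := by linarith
    have hb := RM_bound hC (s := s) (by linarith)
    have hb2 : C / (s.re - (σ₀ + σ₁) / 2) ≤ C / (σ₁ - (σ₀ + σ₁) / 2) := by gcongr
    have h3 : ‖s - 1‖ ≤ 1 + ‖s‖ := by
      have := norm_sub_le s 1; rw [norm_one] at this; linarith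
    calc ‖GG p ρ s‖ ≤ ‖(ρ : ℂ)‖ + ‖s - 1‖ * ‖RM (fun x => (NP p x : ℝ) - ρ * x) s‖ := by
          unfold GG; rw [← norm_mul]; exact norm_add_le _ _
      _ ≤ ρ + (1 + ‖s‖) * (C / (σ₁ - (σ₀ + σ₁) / 2)) := by
          rw [norm_real, Real.norm_eq_abs, abs_of_pos hρ]
          gcongr
          exact hb.trans hb2
      _ ≤ _ := by
          nlinarith [norm_nonneg s]
  · obtain ⟨C, _, hC⟩ := N_lin hρ h1 hN
    exact G_near hp hfin hC hmono

lemma final_M (hne : ∀ s : ℂ, σ₀ < s.re → GG p ρ s ≠ 0) {σ : ℝ} (hσ : σ₀ < σ) (hσ1 : σ < 1) :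
    MP p =O[atTop] fun x => x ^ σ := by
  have hg := goodG hmono hp hfin hρ h0 h1 hN hne
  obtain ⟨C, hC0, hC⟩ := N_lin hρ h1 hN
  set σ' := (σ₀ + σ) / 2 with hσ'
  have ha : σ₀ < σ' := by simp only [hσ']; linarith
  have hb : σ' < σ := by simp only [hσ']; linarith
  obtain ⟨K, hK0, hK⟩ := hN σ' ha
  have := main_M (σ := σ') (δ := σ - σ') (C := C) (D := ρ + 3 * K) hg ha (by linarith) (by linarith)
    (by linarith) (M_meas hfin) hC0
    (fun x hx => (M_le hfin hp x).trans (hC x hx)) (by positivity) ?_ (fun s hs => E_M hp hfin hC hs)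
  · rwa [add_sub_cancel] at this
  · intro x y hx hxy hy
    have h2 := (abs_le.mp (M_diff hfin hxy)).1
    have h3 := (abs_le.mp (hK x hx)).1
    have h4 := (abs_le.mp (hK y (by linarith))).2
    have h5 := two_rpow hx hxy hy (σ := σ') (by linarith) (by linarith)
    have h6 : 0 ≤ x ^ σ' := Real.rpow_nonneg (by linarith) _
    have h7 : K * y ^ σ' ≤ K * (2 * x ^ σ') := by gcongr
    have h8 : 0 ≤ K * (y - x) := mul_nonneg hK0 (by linarith)
    have h9 : 0 ≤ ρ * x ^ σ' := by positivity
    nlinarith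

lemma final_psi (hψ : ∃ C, 0 ≤ C ∧ ∀ x, 1 ≤ x → |psiP p x - x| ≤ C * x)
    (hne : ∀ s : ℂ, σ₀ < s.re → GG p ρ s ≠ 0) {σ : ℝ} (hσ : σ₀ < σ) (hσ1 : σ < 1) :
    (fun x => psiP p x - x) =O[atTop] fun x => x ^ σ := by
  have hg := goodG hmono hp hfin hρ h0 h1 hN hne
  obtain ⟨C, hC0, hC⟩ := N_lin hρ h1 hN
  obtain ⟨K, hK0, hK⟩ := hψ
  have hK' : ∀ x, 1 ≤ x → psiP p x ≤ (K + 1) * x := by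
    intro x hx
    have := (abs_le.mp (hK x hx)).2
    linarith
  set σ' := (σ₀ + σ) / 2 with hσ'
  have ha : σ₀ < σ' := by simp only [hσ']; linarith
  have hb : σ' < σ := by simp only [hσ']; linarith
  have := main_psi (σ := σ') (δ := σ - σ') (C := K) (D := 1) hg ha (by linarith) (by linarith)
    (by linarith) ((psi_mono hfin hp).measurable.sub measurable_id) hK0
    hK zero_le_one ?_ (fun s hs => E_psi hp hfin hC hK' hs)
  · rwa [add_sub_cancel] at this
  · intro x y hx hxy hy
    have h2 := psi_mono hfin hp hxy
    have h6 : 0 ≤ x ^ σ' := Real.rpow_nonneg (by linarith) _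
    simp only [Pi.sub_apply, id]
    linarith

lemma ne_of_psi (hψ : ∀ θ, σ₀ < θ → ∃ C, 0 ≤ C ∧ ∀ x, 1 ≤ x → |psiP p x - x| ≤ C * x ^ θ) :
    ∀ s : ℂ, σ₀ < s.re → GG p ρ s ≠ 0 := by
  obtain ⟨C, hC0, hC⟩ := N_lin hρ h1 hN
  have hK' : ∃ C', ∀ x, 1 ≤ x → psiP p x ≤ C' * x := by
    obtain ⟨K, hK0, hK⟩ := hψ 1 h1
    refine ⟨K + 1, fun x hx => ?_⟩
    have := (abs_le.mp (hK x hx)).2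
    rw [Real.rpow_one] at this
    linarith
  obtain ⟨C', hC'⟩ := hK'
  have hs0 : ∀ s : ℂ, σ₀ < s.re → s ≠ 0 := by
    rintro s hs rfl; simp at hs; linarith
  set K : ℂ → ℂ := fun s => -1 - 1 / s - s * RM (fun x => psiP p x - x) s with hK
  have hKd : ∀ s : ℂ, σ₀ < s.re → DifferentiableAt ℂ K s := by
    intro s hs
    obtain ⟨B, _, hB⟩ := hψ ((σ₀ + s.re) / 2) (by linarith)
    have h2 : DifferentiableAt ℂ (RM (fun x => psiP p x - x)) s :=
      RM_diff ((psi_mono hfin hp).measurable.sub measurable_id) hB (by linarith)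
    exact (((differentiableAt_const _).sub ((differentiableAt_const _).div differentiableAt_id (hs0 s hs))).sub
      (differentiableAt_id.mul h2))
  have hGd := GG_diff hfin hN
  have hd : ∀ s : ℂ, σ₀ < s.re → DifferentiableAt ℂ (deriv (GG p ρ)) s := by
    intro s hs
    have hGo : DifferentiableOn ℂ (GG p ρ) {s | σ₀ < s.re} := fun z hz => (hGd z hz).differentiableWithinAt
    exact (hGo.deriv (isOpen_hp σ₀)).differentiableAt ((isOpen_hp σ₀).mem_nhds hs)
  have hde := ident_hp (f := deriv (GG p ρ)) (g := fun s => K s * GG p ρ s) hd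
    (fun s hs => (hKd s hs).mul (hGd s hs)) (by
      intro s hs
      have hG0 := G_ne (ρ := ρ) hp hfin hC hs
      have h3 := E_psi (ρ := ρ) hp hfin hC hC' hs
      have := hs0 s (by linarith)
      simp only [hK]
      rw [← h3]
      field_simp
      ring)
  obtain ⟨Φ, hΦ⟩ := halfplane_primitive hKd
  obtain ⟨c, hc⟩ := const_of_deriv_zero (σ := σ₀) (f := fun s => GG p ρ s * exp (-Φ s)) (by
    intro s hs
    have h1 := (hGd s hs).hasDerivAt.mul ((hΦ s hs).neg.cexp)
    refine h1.congr_deriv ?_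
    rw [hde s hs]
    ring)
  have hc0 : c ≠ 0 := by
    rw [← hc 2 (by simp; linarith)]
    exact mul_ne_zero (G_ne hp hfin hC (by simp)) (exp_ne_zero _)
  intro s hs hG
  apply hc0
  rw [← hc s hs, hG, zero_mul]

lemma ne_of_M (hM : ∀ θ, σ₀ < θ → ∃ C, 0 ≤ C ∧ ∀ x, 1 ≤ x → |MP p x| ≤ C * x ^ θ) :
    ∀ s : ℂ, σ₀ < s.re → GG p ρ s ≠ 0 := by
  obtain ⟨C, hC0, hC⟩ := N_lin hρ h1 hN
  have hs0 : ∀ s : ℂ, σ₀ < s.re → s ≠ 0 := by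
    rintro s hs rfl; simp at hs; linarith
  have hde := ident_hp (σ := σ₀) (f := fun s => s - 1) (g := fun s => RM (MP p) s * (s ^ 2 * GG p ρ s))
    (fun s hs => by fun_prop) (by
      intro s hs
      obtain ⟨B, _, hB⟩ := hM ((σ₀ + s.re) / 2) (by linarith)
      have h2 : DifferentiableAt ℂ (RM (MP p)) s := RM_diff (M_meas hfin) hB (by linarith)
      have h3 := GG_diff hfin hN s hs
      fun_prop) (by
      intro s hs
      have hG0 := G_ne (ρ := ρ) hp hfin hC hs
      have := hs0 s (by linarith)
      rw [← E_M (ρ := ρ) hp hfin hC hs]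
      field_simp)
  intro s hs hG
  have h2 := hde s hs
  simp only [hG, mul_zero] at h2
  have h3 : s = 1 := sub_eq_zero.mp h2
  rw [h3] at hG
  simp [GG] at hG
  linarith

end two

end

lemma upward {f : ℝ → ℝ} {θ θ' : ℝ} (h : f =O[atTop] fun x => x ^ θ) (hle : θ ≤ θ') :
    f =O[atTop] fun x => x ^ θ' := by
  refine h.trans (IsBigO.of_bound 1 ?_)
  filter_upwards [eventually_ge_atTop 1] with x hx
  have h0 : 0 ≤ x ^ θ := Real.rpow_nonneg (by linarith) _
  have h1 : 0 ≤ x ^ θ' := Real.rpow_nonneg (by linarith) _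
  rw [Real.norm_eq_abs, Real.norm_eq_abs, abs_of_nonneg h0, abs_of_nonneg h1, one_mul]
  exact Real.rpow_le_rpow_of_exponent_le hx hle

lemma above_inf {f : ℝ → ℝ} (hne : {θ : ℝ | f =O[atTop] fun x => x ^ θ}.Nonempty) {θ : ℝ}
    (h : sInf {θ : ℝ | f =O[atTop] fun x => x ^ θ} < θ) : f =O[atTop] fun x => x ^ θ := by
  obtain ⟨a, ha, hlt⟩ := exists_lt_of_csInf_lt hne h
  exact upward ha hlt.le

lemma SN_nonneg {g : ℝ → ℕ} {ρ θ : ℝ} (hρ : 0 < ρ)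
    (h : (fun x => (g x : ℝ) - ρ * x) =O[atTop] fun x => x ^ θ) : 0 ≤ θ := by
  by_contra hneg
  push Not at hneg
  have ht : Tendsto (fun x : ℝ => x ^ θ) atTop (nhds 0) := by
    have := tendsto_rpow_neg_atTop (y := -θ) (by linarith)
    simpa using this
  have h2 := h.trans_tendsto ht
  have h3 : Tendsto (fun k : ℕ => ((k:ℝ) + 1 / 2) / ρ) atTop atTop :=
    (tendsto_atTop_add_const_right _ _ tendsto_natCast_atTop_atTop).atTop_div_const hρ
  have h4 := h2.comp h3
  have h5 := (h4.eventually (Metric.ball_mem_nhds 0 (ε := 1 / 2) (by norm_num))).exists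
  obtain ⟨k, hk⟩ := h5
  rw [dist_zero_right, Real.norm_eq_abs] at hk
  simp only [Function.comp] at hk
  rw [mul_div_cancel₀ _ hρ.ne', abs_lt] at hk
  set m := g (((k:ℝ) + 1 / 2) / ρ)
  have h6 : (k:ℝ) < m := by linarith [hk.1]
  have h7 : (m:ℝ) < k + 1 := by linarith [hk.2]
  norm_cast at h6 h7
  omega

theorem stmt2 (p : ℕ → ℝ) (hmono : Monotone p) (hp0 : 1 < p 0)
    (htop : Tendsto p atTop atTop) (ρ : ℝ) (hρ : 0 < ρ)
    (Sψ SN : Set ℝ)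
    (hSψ : Sψ = {θ : ℝ | (fun x => psiP p x - x) =O[atTop] fun x => x ^ θ})
    (hSN : SN = {θ : ℝ | (fun x => (NP p x : ℝ) - ρ * x) =O[atTop] fun x => x ^ θ})
    (hψne : Sψ.Nonempty) (hNne : SN.Nonempty)
    (α β : ℝ) (hα : α = sInf Sψ) (hβ : β = sInf SN)
    (hβα : β < α) (hα1 : α < 1) :
    {θ : ℝ | (fun x => MP p x) =O[atTop] fun x => x ^ θ}.Nonempty ∧
    sInf {θ : ℝ | (fun x => MP p x) =O[atTop] fun x => x ^ θ} = α := by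
  have hp : ∀ i, 1 < p i := fun i => lt_of_lt_of_le hp0 (hmono (Nat.zero_le i))
  have hfin := finE hp hmono htop
  have hβ0 : 0 ≤ β := by
    rw [hβ]
    apply Real.sInf_nonneg
    intro θ hθ
    rw [hSN] at hθ
    exact SN_nonneg hρ hθ
  have hN : ∀ θ, β < θ → ∃ C, 0 ≤ C ∧ ∀ x, 1 ≤ x → |(NP p x : ℝ) - ρ * x| ≤ C * x ^ θ := by
    intro θ hθ
    apply bound_all (fun X => mono_loc (NP_mono hfin) ρ X)
    subst hSN
    exact above_inf hNne (hβ ▸ hθ)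
  have hψ : ∀ θ, α < θ → ∃ C, 0 ≤ C ∧ ∀ x, 1 ≤ x → |psiP p x - x| ≤ C * x ^ θ := by
    intro θ hθ
    apply bound_all (fun X => by simpa using mono_loc (psi_mono hfin hp) 1 X)
    subst hSψ
    exact above_inf hψne (hα ▸ hθ)
  have hψ1 : ∃ C, 0 ≤ C ∧ ∀ x, 1 ≤ x → |psiP p x - x| ≤ C * x := by
    simpa using hψ 1 hα1
  have hbdd : BddBelow Sψ := by
    by_contra hb
    have := Real.sInf_of_not_bddBelow hb
    linarith
  -- upper bound
  have hup : ∀ θ, α < θ → θ < 1 → MP p =O[atTop] fun x => x ^ θ := by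
    intro θ h1 h2
    have hN' : ∀ θ, α < θ → ∃ C, 0 ≤ C ∧ ∀ x, 1 ≤ x → |(NP p x : ℝ) - ρ * x| ≤ C * x ^ θ :=
      fun θ hθ => hN θ (hβα.trans hθ)
    exact final_M hmono hp hfin hρ (by linarith) hα1 hN'
      (ne_of_psi hmono hp hfin hρ (by linarith) hα1 hN' hψ) h1 h2
  -- lower bound
  have hlow : ∀ θ, MP p =O[atTop] (fun x => x ^ θ) → α ≤ θ := by
    intro θ hθ
    by_contra hlt
    push Not at hlt
    set σ₀ := max θ β with hσ₀
    have hσα : σ₀ < α := max_lt hlt hβα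
    have h0 : 0 ≤ σ₀ := hβ0.trans (le_max_right _ _)
    have hN' : ∀ θ, σ₀ < θ → ∃ C, 0 ≤ C ∧ ∀ x, 1 ≤ x → |(NP p x : ℝ) - ρ * x| ≤ C * x ^ θ :=
      fun θ hθ => hN θ ((le_max_right _ _).trans_lt hθ)
    have hM : ∀ θ, σ₀ < θ → ∃ C, 0 ≤ C ∧ ∀ x, 1 ≤ x → |MP p x| ≤ C * x ^ θ := by
      intro θ' hθ'
      apply bound_all _ (upward hθ ((le_max_left _ _).trans hθ'.le))
      intro X
      exact ⟨NP p X, fun x _ hx => (M_le hfin hp x).trans (NP_mono hfin hx)⟩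
    have hs : σ₀ < (σ₀ + α) / 2 := by linarith
    have := final_psi hmono hp hfin hρ h0 (by linarith) hN' hψ1
      (ne_of_M hmono hp hfin hρ h0 (by linarith) hN' hM) hs (by linarith)
    have hmem : (σ₀ + α) / 2 ∈ Sψ := by rw [hSψ]; exact this
    have := csInf_le hbdd hmem
    rw [← hα] at this
    linarith
  have hne : {θ : ℝ | (fun x => MP p x) =O[atTop] fun x => x ^ θ}.Nonempty :=
    ⟨(α + 1) / 2, hup _ (by linarith) (by linarith)⟩
  refine ⟨hne, le_antisymm ?_ (le_csInf hne (fun θ hθ => hlow θ hθ))⟩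
  apply le_of_forall_gt_imp_ge_of_dense
  intro θ hθ
  have h1 : α < min θ ((α + 1) / 2) := lt_min hθ (by linarith)
  have h2 : min θ ((α + 1) / 2) < 1 := (min_le_right _ _).trans_lt (by linarith)
  exact (csInf_le ⟨α, fun θ hθ => hlow θ hθ⟩ (hup _ h1 h2)).trans (min_le_left _ _)
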